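/- arXiv:2601.01379 — 2 statements merged into one kernel-verified Lean document; each statement's English description precedes it below -/
import Mathlib

section
/- For every positive integer k and every positive integer r with 2r+1 ≤ n := k(k+1)/2, the normalized value of the staircase character at a (2r+1)-cycle is ψ_k((2r+1))/ψ_k(1) = (−2)^{−r} · C(r) · Δ(n, r) / Π_{a=1}^{2r}(n − a), where C(r) is the r-th Catalan number and Δ(n,r) = Π_{i=1}^{r}(n − i(i+1)/2). -/
open CategoryTheory in
lemma schur_scalar {G : Type} [Group G] (V : FDRep ℂ G) [Simple V]
    (φ : V →ₗ[ℂ] V) (hφ : ∀ g : G, φ ∘ₗ V.ρ g = V.ρ g ∘ₗ φ) :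
    ∃ c : ℂ, φ = c • LinearMap.id := by
  let F : V ⟶ V := ⟨InducedCategory.homMk (ModuleCat.ofHom φ), fun g ↦ by
    ext x
    exact LinearMap.congr_fun (hφ g) x⟩
  obtain ⟨c, hc⟩ := CategoryTheory.endomorphism_simple_eq_smul_id ℂ F
  refine ⟨c, ?_⟩
  have := congrArg (fun (f : V ⟶ V) => f.hom.hom.hom) hc
  exact this.symm

open CategoryTheory in
lemma char_sum_scalar {G : Type} [Group G] [Fintype G] (V : FDRep ℂ G) [Simple V]
    (f : G → ℂ) (hf : ∀ g h, f (g * h * g⁻¹) = f h) :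
    ∃ c : ℂ, ∀ g, ∑ h, f h * V.character (h * g) = c * V.character g := by
  obtain ⟨c, hc⟩ := schur_scalar V (∑ h, f h • V.ρ h) (by
    intro g
    rw [← Module.End.mul_eq_comp, ← Module.End.mul_eq_comp, Finset.sum_mul, Finset.mul_sum]
    refine Fintype.sum_equiv (MulAut.conj g⁻¹).toEquiv _ _ ?_
    intro h
    have h1 : f (g⁻¹ * h * g) = f h := by simpa using hf g⁻¹ h
    rw [mul_assoc] at h1
    simp [h1, ← map_mul, mul_assoc])
  refine ⟨c, fun g => ?_⟩
  have := congrArg (fun φ => LinearMap.trace ℂ V (φ * V.ρ g)) hc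
  simp only [Finset.sum_mul, map_sum] at this
  simpa [FDRep.character, map_mul, ← Module.End.one_eq_id] using this

open CategoryTheory in
lemma char_conv {G : Type} [Group G] [Fintype G] (V : FDRep ℂ G) [Simple V] (g : G) :
    (Module.finrank ℂ V : ℂ) * ∑ h, V.character h * V.character (h⁻¹ * g) =
      (Fintype.card G : ℂ) * V.character g := by
  obtain ⟨c, hc⟩ := char_sum_scalar V (fun h => V.character h⁻¹) (by
    intro g h
    simp [mul_assoc]
    rw [← mul_assoc]; simp)
  have : Invertible (Nat.card G : ℂ) := invertibleOfNonzero (by simp)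
  have h1 := FDRep.char_orthonormal V V
  rw [if_pos ⟨Iso.refl V⟩] at h1
  have h2 := hc 1
  simp only [mul_one, FDRep.char_one] at h2
  have h3 : ∑ h, V.character h⁻¹ * V.character h = (Fintype.card G : ℂ) := by
    rw [inv_mul_eq_iff_eq_mul₀ (by simp)] at h1
    simp only [mul_comm] at h1 ⊢
    simpa using h1
  have h4 : ∑ h, V.character h * V.character (h⁻¹ * g) = c * V.character g := by
    rw [← hc g]
    refine Fintype.sum_equiv (Equiv.inv G) _ _ ?_
    intro h; simp
  rw [h4, ← h3, h2]; ring

open CategoryTheory in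
lemma char_isIntegral {G : Type} [Group G] [Finite G] (V : FDRep ℂ G) (g : G) :
    IsIntegral ℤ (V.character g) := by
  classical
  have hN : 0 < orderOf g := orderOf_pos g
  rw [FDRep.character, Module.End.trace_eq_sum_roots_charpoly_of_splits (IsAlgClosed.splits _)]
  apply IsIntegral.multiset_sum
  intro x hx
  rw [Polynomial.mem_roots'] at hx
  have hev : Module.End.HasEigenvalue (V.ρ g) x := by
    rw [Module.End.hasEigenvalue_iff_isRoot_charpoly]; exact hx.2
  obtain ⟨v, hv⟩ := hev.exists_hasEigenvector
  have h1 := hv.pow_apply (orderOf g)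
  rw [← map_pow, pow_orderOf_eq_one] at h1
  simp only [map_one, Module.End.one_apply] at h1
  have h2 : x ^ orderOf g = 1 := by
    have : (x ^ orderOf g - 1) • v = 0 := by rw [sub_smul, ← h1]; simp
    rcases smul_eq_zero.1 this with h | h
    · linear_combination h
    · exact absurd h hv.2
  exact IsIntegral.of_pow hN (by rw [h2]; exact isIntegral_one)


/-- product of a word, read off a periodic extension -/
def wprod {G : Type} [Group G] {N : ℕ} (w : Fin (N + 1) → G) (L : ℕ) : G :=
  ((List.range L).map (fun t => w (Fin.ofNat (N + 1) t))).prod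

lemma wprod_add {G : Type} [Group G] {N : ℕ} (w : Fin (N + 1) → G) (q : ℕ)
    (hq : ∀ i, w (i + Fin.ofNat (N + 1) q) = w i) (s : ℕ) :
    wprod w (q * s) = (wprod w q) ^ s := by
  have hq2 : ∀ s t, w (Fin.ofNat (N + 1) (q * s + t)) = w (Fin.ofNat (N + 1) t) := by
    intro s
    induction s with
    | zero => intro t; simp
    | succ s ih =>
      intro t
      rw [← ih t, ← hq (Fin.ofNat (N + 1) (q * s + t))]
      congr 1
      ext
      simp only [Fin.ofNat, Fin.val_add]
      rw [← Nat.add_mod]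
      congr 1
      ring
  induction s with
  | zero => simp [wprod]
  | succ s ih =>
    rw [pow_succ, ← ih, Nat.mul_succ]
    unfold wprod
    rw [List.range_add, List.map_append, List.prod_append, List.map_map]
    congr 2
    apply List.map_congr_left
    intro t _
    exact hq2 s t

lemma wprod_rot {G : Type} [Group G] {N : ℕ} (w : Fin (N + 1) → G) :
    wprod (fun i => w (i + 1)) (N + 1) = (w 0)⁻¹ * wprod w (N + 1) * w 0 := by
  have h1 : wprod w (N + 2) = w 0 * wprod (fun i => w (i + 1)) (N + 1) := by
    unfold wprod
    rw [List.range_succ_eq_map, List.map_cons, List.prod_cons, List.map_map]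
    congr 2
    apply List.map_congr_left
    intro t _
    simp only [Function.comp]
    congr 1
    ext
    simp [Fin.ofNat, Fin.val_add]
  have h2 : wprod w (N + 2) = wprod w (N + 1) * w 0 := by
    unfold wprod
    rw [List.range_succ (n := N + 1), List.map_append, List.prod_append]
    simp [Fin.ofNat]
  rw [mul_assoc, ← h2, h1]; simp

lemma word_sum {G : Type} [Group G] [Fintype G] (χ : G → ℂ) (u v : ℂ)
    (hconv : ∀ g, u * ∑ h, χ h * χ (h⁻¹ * g) = v * χ g) (N : ℕ) (φ : G → ℂ) :
    u ^ N * ∑ w : Fin (N + 1) → G, φ (wprod w (N + 1)) * ∏ i, χ (w i) =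
      v ^ N * ∑ g, φ g * χ g := by
  induction N generalizing φ with
  | zero =>
    simp only [pow_zero, one_mul]
    refine Fintype.sum_equiv (Equiv.funUnique (Fin 1) G) _ _ ?_
    intro w
    simp [wprod]
  | succ N ih =>
    have h0 : ∑ w : Fin (N + 2) → G, φ (wprod w (N + 2)) * ∏ i, χ (w i) =
        ∑ x : G, χ x * ∑ w : Fin (N + 1) → G, φ (x * wprod w (N + 1)) * ∏ i, χ (w i) := by
      rw [← (Fin.consEquiv (fun _ => G)).sum_comp, Fintype.sum_prod_type]
      refine Finset.sum_congr rfl fun x _ => ?_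
      rw [Finset.mul_sum]
      refine Finset.sum_congr rfl fun w _ => ?_
      have : wprod (Fin.cons x w : Fin (N + 2) → G) (N + 2) = x * wprod w (N + 1) := by
        unfold wprod
        rw [List.range_succ_eq_map, List.map_cons, List.prod_cons, List.map_map]
        refine congrArg₂ (· * ·) (by simp [Fin.ofNat]) (congrArg List.prod ?_)
        apply List.map_congr_left
        intro t ht
        rw [List.mem_range] at ht
        simp only [Function.comp]
        have : Fin.ofNat (N + 1 + 1) t.succ = (Fin.ofNat (N + 1) t).succ := by
          ext
          simp only [Fin.ofNat, Fin.val_succ]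
          rw [Nat.mod_eq_of_lt ht, Nat.mod_eq_of_lt (by omega)]
        rw [this, Fin.cons_succ]
      have h3 : (Fin.consEquiv fun _ => G) (x, w) = (Fin.cons x w : Fin (N + 2) → G) := rfl
      rw [h3, this, Fin.prod_univ_succ]
      simp
      ring
    rw [h0, pow_succ', mul_assoc, Finset.mul_sum]
    have h1 : ∀ x : G, u ^ N * (χ x * ∑ w : Fin (N + 1) → G, φ (x * wprod w (N + 1)) * ∏ i, χ (w i))
        = v ^ N * ∑ y, φ y * (χ x * χ (x⁻¹ * y)) := by
      intro x
      have := ih (fun y => φ (x * y))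
      rw [mul_left_comm, this, mul_left_comm, Finset.mul_sum]
      congr 1
      refine Fintype.sum_equiv (Equiv.mulLeft x) _ _ fun y => ?_
      simp
      ring
    rw [Finset.sum_congr rfl fun x _ => h1 x, ← Finset.mul_sum, Finset.sum_comm, mul_left_comm,
      pow_succ, mul_assoc]
    congr 1
    rw [Finset.mul_sum, Finset.mul_sum]
    refine Finset.sum_congr rfl fun y _ => ?_
    rw [← Finset.mul_sum, mul_left_comm, hconv]
    ring

lemma orbit_sum_dvd {X : Type} [Fintype X] [DecidableEq X] (ρ : Equiv.Perm X) (m j : ℕ)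
    (hρ : ρ ^ (2 ^ m) = 1) (F : X → ℂ) (hF : ∀ x, IsIntegral ℤ (F x))
    (hinv : ∀ x, F (ρ x) = F x) (hfix : ∀ x, F x ≠ 0 → (ρ ^ (2 ^ j)) x ≠ x) :
    ∃ y : ℂ, IsIntegral ℤ y ∧ ∑ x, F x = 2 ^ j * y := by
  classical
  have hinv' : ∀ (s : Subgroup.zpowers ρ) x, F (s • x) = F x := by
    rintro ⟨s, hs⟩ x
    rw [Subgroup.mk_smul]
    have : ∀ k : ℕ, ∀ x, F ((ρ ^ k) x) = F x := by
      intro k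
      induction k with
      | zero => simp
      | succ k ih => intro x; rw [pow_succ, Equiv.Perm.mul_apply, ih, hinv]
    obtain ⟨k, hk⟩ := (mem_powers_iff_mem_zpowers).2 hs
    rw [← hk]; exact this k x
  let S := MulAction.orbitRel (Subgroup.zpowers ρ) X
  let π : X → Quotient S := Quotient.mk S
  rw [← Finset.sum_fiberwise (Finset.univ : Finset X) π F]
  have key : ∀ q : Quotient S, ∃ y : ℂ, IsIntegral ℤ y ∧
      ∑ x ∈ Finset.univ.filter (fun x => π x = q), F x = 2 ^ j * y := by
    intro q
    induction q using Quotient.inductionOn with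
    | h x =>
    have hmem : ∀ y, π y = π x ↔ y ∈ MulAction.orbit (Subgroup.zpowers ρ) x := by
      intro y
      exact Quotient.eq (r := S)
    have hconst : ∀ y ∈ Finset.univ.filter (fun y => π y = π x), F y = F x := by
      intro y hy
      rw [Finset.mem_filter, hmem] at hy
      obtain ⟨s, hs⟩ := hy.2
      rw [← hs]; exact hinv' s x
    change ∃ y : ℂ, IsIntegral ℤ y ∧
      ∑ z ∈ Finset.univ.filter (fun z => π z = π x), F z = 2 ^ j * y
    rw [Finset.sum_congr rfl hconst, Finset.sum_const]
    by_cases h0 : F x = 0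
    · exact ⟨0, isIntegral_zero, by simp [h0]⟩
    have hcard : (Finset.univ.filter (fun y => π y = π x)).card =
        Function.minimalPeriod (ρ • ·) x := by
      rw [MulAction.minimalPeriod_eq_card, Fintype.card_subtype]
      congr 1
      ext y
      simp [hmem]
    have hp : Function.minimalPeriod (ρ • ·) x ∣ 2 ^ m := by
      rw [← MulAction.pow_smul_eq_iff_minimalPeriod_dvd, hρ, one_smul]
    obtain ⟨i, hi, hi2⟩ := (Nat.dvd_prime_pow Nat.prime_two).1 hp
    have hij : j ≤ i := by
      by_contra hlt
      push Not at hlt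
      apply hfix x h0
      have : Function.minimalPeriod (ρ • ·) x ∣ 2 ^ j := by
        rw [hi2]; exact pow_dvd_pow 2 hlt.le
      exact (MulAction.pow_smul_eq_iff_minimalPeriod_dvd).2 this
    refine ⟨(2 ^ (i - j) : ℤ) * F x, (isIntegral_algebraMap (A := ℂ) (R := ℤ)).mul (hF x), ?_⟩
    rw [hcard, hi2, nsmul_eq_mul]
    push_cast
    rw [← mul_assoc, ← pow_add, Nat.add_sub_cancel' hij]
  choose y hy1 hy2 using key
  refine ⟨∑ q, y q, IsIntegral.sum _ fun q _ => hy1 q, ?_⟩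
  rw [Finset.mul_sum]
  exact Finset.sum_congr rfl fun q _ => hy2 q

lemma eq_zero_of_two_pow_dvd (z : ℂ) (hz : IsIntegral ℤ z)
    (h : ∀ j : ℕ, ∃ y : ℂ, IsIntegral ℤ y ∧ z = 2 ^ j * y) : z = 0 := by
  by_contra hne

  have hM : ∃ (M : ℤ) (z' : ℂ), M ≠ 0 ∧ IsIntegral ℤ z' ∧ z * z' = M := by
    have hc : (minpoly ℤ z).coeff 0 ≠ 0 := by
      have h1 := minpoly.coeff_zero_ne_zero (hz.tower_top (A := ℚ)) hne
      rw [minpoly.isIntegrallyClosed_eq_field_fractions' ℚ hz, Polynomial.coeff_map] at h1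
      intro h2
      rw [h2] at h1
      simp at h1
    refine ⟨-(minpoly ℤ z).coeff 0, Polynomial.aeval z (minpoly ℤ z).divX, by simpa using hc, ?_, ?_⟩
    · exact IsIntegral.of_mem_of_fg (Algebra.adjoin ℤ {z}) hz.fg_adjoin_singleton _
        (Polynomial.aeval_mem_adjoin_singleton ℤ z)
    · have := minpoly.aeval ℤ z
      rw [← Polynomial.X_mul_divX_add (minpoly ℤ z)] at this
      simp at this
      push_cast
      linear_combination this
  obtain ⟨M, z', hM0, hz', hzM⟩ := hM
  have hdiv : ∀ j : ℕ, (2 : ℤ) ^ j ∣ M := by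
    intro j
    obtain ⟨y, hy, hzy⟩ := h j
    have h1 : IsIntegral ℤ (y * z') := hy.mul hz'
    have h2 : y * z' = algebraMap ℚ ℂ ((M : ℚ) / 2 ^ j) := by
      have : (M : ℂ) = 2 ^ j * (y * z') := by rw [← hzM, hzy]; ring
      simp [this]
    rw [h2, isIntegral_algebraMap_iff (algebraMap ℚ ℂ).injective] at h1
    obtain ⟨a, ha⟩ := IsIntegrallyClosed.isIntegral_iff.1 h1
    refine ⟨a, ?_⟩
    have h3 : (M : ℚ) = 2 ^ j * a := by
      simp at ha
      rw [ha]; field_simp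
    exact_mod_cast h3
  have := Int.le_of_dvd (abs_pos.2 hM0) ((dvd_abs _ _).2 (hdiv (M.natAbs)))
  have h2 := Nat.lt_two_pow_self (n := M.natAbs)
  zify at h2
  omega

lemma defect_zero_vanish {G : Type} [Group G] [Fintype G] (χ : G → ℂ)
    (hclass : ∀ g h, χ (g * h * g⁻¹) = χ h) (hinteg : ∀ h, IsIntegral ℤ (χ h)) (d : ℕ) (hd : d ≠ 0)
    (hconv : ∀ g, (d : ℂ) * ∑ h, χ h * χ (h⁻¹ * g) = (Fintype.card G : ℂ) * χ g)
    (hdef : (Fintype.card G).factorization 2 = d.factorization 2)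
    (g : G) (hg : 2 ∣ orderOf g) : χ g = 0 := by
  classical
  obtain ⟨c, v, hv, hGv⟩ := Nat.exists_eq_two_pow_mul_odd (n := Fintype.card G) Fintype.card_ne_zero
  obtain ⟨c', u, hu, hdu⟩ := Nat.exists_eq_two_pow_mul_odd hd
  have hfac : ∀ (c v : ℕ), Odd v → (2 ^ c * v).factorization 2 = c := by
    intro c v hv
    have hv0 : v ≠ 0 := by rintro rfl; simp at hv
    rw [Nat.factorization_mul (by positivity) hv0]
    have h2v : v.factorization 2 = 0 := by
      apply Nat.factorization_eq_zero_of_not_dvd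
      intro h
      exact (Nat.not_even_iff_odd.2 hv) (even_iff_two_dvd.2 h)
    simp [Nat.prime_two.factorization, h2v]
  have hcc : c = c' := by
    rw [hGv, hdu, hfac _ _ hv, hfac _ _ hu] at hdef
    exact hdef
  subst hcc
  have hconv' : ∀ g, (u : ℂ) * ∑ h, χ h * χ (h⁻¹ * g) = (v : ℂ) * χ g := by
    intro g
    have := hconv g
    rw [hGv, hdu] at this
    push_cast at this
    have h2 : (2 : ℂ) ^ c ≠ 0 := pow_ne_zero _ two_ne_zero
    apply mul_left_cancel₀ h2
    linear_combination this
  let φ : G → ℂ := fun x => if IsConj g x then 1 else 0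
  let K : ℕ := (Finset.univ.filter (fun x => IsConj g x)).card
  have hφ1 : ∀ x, IsConj g x → φ x = 1 := fun x hx => if_pos hx
  have hφ0 : ∀ x, ¬ IsConj g x → φ x = 0 := fun x hx => if_neg hx
  have hK : K ≠ 0 := by
    apply Finset.card_ne_zero_of_mem (a := g)
    exact Finset.mem_filter.2 ⟨Finset.mem_univ _, IsConj.refl g⟩
  have hsum : ∑ x, φ x * χ x = K * χ g := by
    have : ∀ x, φ x * χ x = if IsConj g x then χ g else 0 := by
      intro x
      by_cases hx : IsConj g x
      · obtain ⟨y, hy⟩ := isConj_iff.1 hx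
        rw [hφ1 x hx, if_pos hx, ← hy, hclass, one_mul]
      · rw [hφ0 x hx, if_neg hx, zero_mul]
    simp only [this, ← Finset.sum_filter, K, Finset.sum_const, nsmul_eq_mul]
  have hz : (K : ℂ) * χ g = 0 := by
    have hzint : IsIntegral ℤ ((K : ℂ) * χ g) := by
      refine IsIntegral.mul ?_ (hinteg g)
      exact (isIntegral_algebraMap (A := ℂ) (R := ℤ) (x := (K : ℤ)))
    apply eq_zero_of_two_pow_dvd _ hzint
    intro j
    obtain ⟨N, hN⟩ : ∃ N, 2 ^ (j + c) = N + 1 := Nat.exists_eq_succ_of_ne_zero (by positivity)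
    have h1 := word_sum χ u v hconv' N φ
    let ρ : Equiv.Perm (Fin (N + 1) → G) := (Equiv.addRight (1 : Fin (N + 1))).arrowCongr (Equiv.refl G) |>.symm
    have hρ : ∀ w, ρ w = fun i => w (i + 1) := by
      intro w; rfl
    have hρk : ∀ (k : ℕ) w, (ρ ^ k) w = fun i => w (i + Fin.ofNat (N + 1) k) := by
      intro k
      induction k with
      | zero => intro w; ext i; simp [Fin.ofNat]
      | succ k ih =>
        intro w
        rw [pow_succ, Equiv.Perm.mul_apply, ih, hρ]
        funext i
        refine congrArg w ?_
        ext
        simp only [Fin.ofNat, Fin.val_add]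
        simp
        ring_nf
    obtain ⟨y, hy, hsy⟩ := orbit_sum_dvd ρ (j + c) j (by
        rw [hN]
        refine Equiv.ext fun w => ?_
        rw [hρk]
        simp [Fin.ofNat]) (fun w => φ (wprod w (N + 1)) * ∏ i, χ (w i))
      (by
        intro w
        refine IsIntegral.mul ?_ (IsIntegral.prod _ fun i _ => hinteg _)
        by_cases h : IsConj g (wprod w (N + 1))
        · rw [hφ1 _ h]; exact isIntegral_one
        · rw [hφ0 _ h]; exact isIntegral_zero)
      (by
        intro w
        congr 1
        · have : IsConj (wprod w (N + 1)) (wprod (ρ w) (N + 1)) := by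
            rw [hρ, wprod_rot, isConj_iff]
            exact ⟨(w 0)⁻¹, by simp⟩
          simp only [φ]
          congr 1
          exact propext ⟨fun h => h.trans this.symm, fun h => h.trans this⟩
        · rw [hρ]
          exact Fintype.prod_equiv (Equiv.addRight (1 : Fin (N + 1))) _ _ fun i => rfl)
      (by
        intro w hw hfix
        have hc : IsConj g (wprod w (N + 1)) := by
          by_contra h
          simp [hφ0 _ h] at hw
        rw [hρk] at hfix
        have h2 := wprod_add w (2 ^ j) (fun i => congrFun hfix i) (2 ^ c)
        rw [← pow_add, hN] at h2
        have h3 : orderOf g ∣ v := by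
          obtain ⟨y, hy⟩ := isConj_iff.1 hc.symm
          apply orderOf_dvd_of_pow_eq_one
          rw [← hy, conj_pow, h2, ← pow_mul, ← hGv, pow_card_eq_one]
          simp
        exact (Nat.not_even_iff_odd.2 hv) (even_iff_two_dvd.2 (hg.trans h3)))
    rw [hsy, hsum] at h1
    have hcop : IsCoprime ((v : ℤ) ^ N) ((2 : ℤ) ^ j) := by
      apply IsCoprime.pow
      exact_mod_cast (Nat.isCoprime_iff_coprime.2 (Nat.coprime_two_right.2 hv))
    obtain ⟨s, t, hst⟩ := hcop
    have hst' : (s : ℂ) * v ^ N + t * 2 ^ j = 1 := by exact_mod_cast hst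
    refine ⟨s * (u ^ N * y) + t * (K * χ g), ?_, ?_⟩
    · refine IsIntegral.add ?_ ?_
      · refine IsIntegral.mul (isIntegral_algebraMap (A := ℂ) (R := ℤ) (x := s)) (IsIntegral.mul (IsIntegral.pow ?_ _) hy)
        exact (isIntegral_algebraMap (A := ℂ) (R := ℤ) (x := (u : ℤ)))
      · exact IsIntegral.mul (isIntegral_algebraMap (A := ℂ) (R := ℤ) (x := t)) hzint
    · linear_combination (-(K * χ g)) * hst' - s * h1
  rcases mul_eq_zero.1 hz with h | h
  · exact absurd (by exact_mod_cast h) hK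
  · exact h


open Equiv in
lemma class_fun_unique {n : ℕ} (D : Perm (Fin n) → ℂ)
    (hclass : ∀ g h, D (g * h * g⁻¹) = D h)
    (heven : ∀ g, 2 ∣ orderOf g → D g = 0)
    (hT : ∀ h, 2 ∣ orderOf h → ∑ i, ∑ j, (if i ≠ j then D (swap i j * h) else 0) = 0)
    (h1 : D 1 = 0) : ∀ g, D g = 0 := by
  classical
  suffices H : ∀ (m : ℕ) (g : Perm (Fin n)), g.support.card = m → D g = 0 from
    fun g => H _ g rfl
  intro m
  induction m using Nat.strong_induction_on with
  | _ m ih =>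
  intro g hgm
  by_cases hodd : 2 ∣ orderOf g
  · exact heven g hodd
  by_cases hg1 : g = 1
  · rw [hg1, h1]
  obtain ⟨c0, hc0⟩ : ∃ c, g c ≠ c := by
    by_contra hcon
    push Not at hcon
    exact hg1 (Equiv.ext hcon)
  obtain ⟨e0, he0⟩ : ∃ e, e = g c0 := ⟨_, rfl⟩
  obtain ⟨h, hh⟩ : ∃ h, h = swap c0 e0 * g := ⟨_, rfl⟩
  have hgh : g = swap c0 e0 * h := by rw [hh, ← mul_assoc, swap_mul_self, one_mul]
  have hec : e0 ≠ c0 := by rw [he0]; exact hc0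
  have hhc0 : h c0 = c0 := by rw [hh, Perm.mul_apply, ← he0, swap_apply_right]
  have hfix : ∀ x, g x = x → h x = x := by
    intro x hx
    rw [hh, Perm.mul_apply, hx]
    apply swap_apply_of_ne_of_ne
    · rintro rfl; exact hc0 hx
    · rintro rfl
      rw [he0] at hx
      exact hc0 (g.injective hx)

  have hgpow : ∀ t : ℕ, g^[t] = ⇑(g ^ t) := fun t => (Perm.iterate_eq_pow g t)
  have hper : ∀ (σ : Perm (Fin n)) x, Function.minimalPeriod σ x ∣ orderOf σ := by
    intro σ x
    apply Function.IsPeriodicPt.minimalPeriod_dvd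
    rw [Function.IsPeriodicPt, Function.IsFixedPt, Perm.iterate_eq_pow, pow_orderOf_eq_one]
    rfl
  obtain ⟨p, hp⟩ : ∃ p, p = Function.minimalPeriod g c0 := ⟨_, rfl⟩
  have hpodd : ¬ 2 ∣ p := fun h' => hodd (h'.trans (hp ▸ hper g c0))
  have hp1 : p ≠ 1 := by
    intro h'
    rw [h'] at hp
    exact hc0 (Function.minimalPeriod_eq_one_iff_isFixedPt.1 hp.symm)
  obtain ⟨q, hq⟩ : ∃ q, p = q + 1 := ⟨p - 1, by omega⟩
  have hq2 : 2 ≤ q := by omega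
  have hqe : 2 ∣ q := by omega
  have hginj : ∀ s t, s < p → t < p → g^[s] c0 = g^[t] c0 → s = t := by
    intro s t hs ht hst
    exact Function.iterate_injOn_Iio_minimalPeriod (by simpa [← hp] using hs)
      (by simpa [← hp] using ht) hst
  have hgp : g^[p] c0 = c0 := by rw [hp]; exact Function.iterate_minimalPeriod
  have hit : ∀ t, t < q → h^[t] e0 = g^[t + 1] c0 := by
    intro t
    induction t with
    | zero => intro _; simp [he0]
    | succ t iht =>
      intro ht
      rw [Function.iterate_succ_apply', iht (by omega), hh, Perm.mul_apply,
        ← Function.iterate_succ_apply' (f := g)]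
      apply swap_apply_of_ne_of_ne
      · intro h'
        have := hginj (t + 1 + 1) 0 (by omega) (by omega) h'
        omega
      · intro h'
        have := hginj (t + 1 + 1) 1 (by omega) (by omega) (by rw [h', he0]; rfl)
        omega
  have hhq : h^[q] e0 = e0 := by
    obtain ⟨q', rfl⟩ : ∃ q', q = q' + 1 := ⟨q - 1, by omega⟩
    rw [Function.iterate_succ_apply', hit q' (by omega), hh, Perm.mul_apply,
        ← Function.iterate_succ_apply' (f := g), Nat.succ_eq_add_one, ← hq, hgp, swap_apply_left]
  have hmin : Function.minimalPeriod h e0 = q := by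
    apply le_antisymm
    · exact Function.IsPeriodicPt.minimalPeriod_le (by omega) hhq
    · by_contra hlt
      push Not at hlt
      have hpos : 0 < Function.minimalPeriod h e0 :=
        Function.IsPeriodicPt.minimalPeriod_pos (n := q) (by omega) hhq
      have h3 := Function.iterate_minimalPeriod (f := h) (x := e0)
      rw [hit _ hlt] at h3
      have := hginj (Function.minimalPeriod h e0 + 1) 1 (by omega) (by omega) (by rw [h3, he0]; rfl)
      omega
  let E : Set (Fin n) := {x | ∃ t : ℕ, h^[t] e0 = x}
  have hEfix : ∀ x ∈ E, h x ≠ x := by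
    rintro x ⟨t, rfl⟩ hx
    rw [← Function.iterate_succ_apply' (f := h), Function.iterate_succ_apply] at hx
    have h2 := (h.injective.iterate t) hx
    have := Function.minimalPeriod_eq_one_iff_isFixedPt.2 h2
    omega
  have hcard : ∀ σ : Perm (Fin n), (∀ x, h x = x → σ x = x) → D σ = 0 := by
    intro σ hσ
    refine ih σ.support.card ?_ σ rfl
    rw [← hgm]
    apply Finset.card_lt_card
    refine (Finset.ssubset_iff_of_subset ?_).2 ⟨c0, ?_, ?_⟩
    · intro x hx
      rw [Perm.mem_support] at hx ⊢
      exact fun h' => hx (hσ x (hfix x h'))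
    · rw [Perm.mem_support]; exact hc0
    · rw [Perm.mem_support, not_not]; exact hσ _ hhc0
  have hconj : ∀ i ∈ E, ∀ j, h j = j → D (swap i j * h) = D g := by
    rintro i ⟨t, rfl⟩ j hj
    have hpj : (h ^ t) j = j := by
      rw [← Perm.iterate_eq_pow]
      exact Function.iterate_fixed hj t
    have e1 : swap (h^[t] e0) j * h = h ^ t * (swap e0 j * h) * (h ^ t)⁻¹ := by
      have h5 := swap_apply_apply (h ^ t) e0 j
      rw [hpj] at h5
      rw [Perm.iterate_eq_pow, h5, mul_assoc, mul_assoc, mul_assoc, mul_assoc]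
      congr 2
      exact ((Commute.refl h).pow_left t).inv_left.eq
    rw [e1, hclass]
    have hne : e0 ≠ j := by
      rintro rfl
      exact hEfix e0 ⟨0, rfl⟩ hj
    have hs : swap c0 j * h = h * swap c0 j := by
      have h5 := swap_apply_apply h c0 j
      rw [hhc0, hj] at h5
      nth_rewrite 1 [h5]
      simp
    have e2 : swap e0 j * h = swap c0 j * g * (swap c0 j)⁻¹ := by
      have h5 := swap_apply_apply (swap c0 j) e0 c0
      rw [swap_apply_of_ne_of_ne hec hne, swap_apply_left] at h5
      rw [h5, hgh, swap_comm c0 e0]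
      simp only [mul_assoc]
      congr 2
    rw [e2, hclass]
  have hout : ∀ i j, i ∉ E → j ∉ E → D (swap i j * h) = 0 := by
    intro i j hi hj
    apply heven
    have hst : ∀ t, (swap i j * h : Perm (Fin n))^[t] e0 = h^[t] e0 := by
      intro t
      induction t with
      | zero => rfl
      | succ t iht =>
        rw [Function.iterate_succ_apply', iht, Perm.mul_apply, ← Function.iterate_succ_apply' (f := h)]
        apply swap_apply_of_ne_of_ne
        · rintro h'; exact hi ⟨_, h'⟩
        · rintro h'; exact hj ⟨_, h'⟩
    have h5 : Function.minimalPeriod (swap i j * h : Perm (Fin n)) e0 = q := by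
      rw [← hmin]
      apply Function.minimalPeriod_eq_minimalPeriod_iff.2
      intro t
      rw [Function.IsPeriodicPt, Function.IsPeriodicPt, Function.IsFixedPt, Function.IsFixedPt, hst]
    exact hqe.trans (h5 ▸ hper _ e0)
  let P : Fin n → Fin n → Prop := fun i j => i ≠ j ∧ ((i ∈ E ∧ h j = j) ∨ (j ∈ E ∧ h i = i))
  have hsum := hT h (hqe.trans (hmin ▸ hper h e0))
  have hterm : ∀ i j, (if i ≠ j then D (swap i j * h) else 0) = if P i j then D g else 0 := by
    intro i j
    by_cases hij : i ≠ j
    · rw [if_pos hij]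
      by_cases h6 : i ∈ E ∧ h j = j
      · rw [if_pos ⟨hij, Or.inl h6⟩]; exact hconj i h6.1 j h6.2
      by_cases h7 : j ∈ E ∧ h i = i
      · rw [if_pos ⟨hij, Or.inr h7⟩, swap_comm]; exact hconj j h7.1 i h7.2
      rw [if_neg (by rintro ⟨_, h8 | h8⟩ <;> contradiction)]
      by_cases h8 : i ∉ E ∧ j ∉ E
      · exact hout i j h8.1 h8.2
      apply hcard
      have hi : h i ≠ i := by
        intro h9
        have h10 : i ∉ E := fun h' => hEfix i h' h9
        have h11 : j ∉ E := fun h' => h7 ⟨h', h9⟩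
        exact h8 ⟨h10, h11⟩
      have hj : h j ≠ j := by
        intro h9
        have h10 : j ∉ E := fun h' => hEfix j h' h9
        have h11 : i ∉ E := fun h' => h6 ⟨h', h9⟩
        exact h8 ⟨h11, h10⟩
      intro x hx
      rw [Perm.mul_apply, hx]
      apply swap_apply_of_ne_of_ne
      · rintro rfl; exact hi hx
      · rintro rfl; exact hj hx
    · rw [if_neg hij, if_neg (fun h' => hij h'.1)]
  simp only [hterm] at hsum
  rw [← Finset.sum_product', ← Finset.sum_filter, Finset.sum_const, nsmul_eq_mul] at hsum
  rcases mul_eq_zero.1 hsum with h' | h'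
  · exfalso
    rw [Nat.cast_eq_zero, Finset.card_eq_zero] at h'
    have : (e0, c0) ∈ (∅ : Finset (Fin n × Fin n)) := by
      rw [← h']
      simp only [Finset.mem_filter, Finset.mem_product, Finset.mem_univ, true_and]
      exact ⟨hec, Or.inl ⟨⟨0, rfl⟩, hhc0⟩⟩
    simp at this
  · exact h'


open MvPolynomial Equiv in
/-- power-sum polynomial attached to a permutation -/
noncomputable def pg {α : Type} [Fintype α] [DecidableEq α] (k : ℕ) (g : Perm α) :
    MvPolynomial (Fin k) ℂ :=
  ∑ f : α → Fin k, if (∀ x, f (g x) = f x) then ∏ x, X (f x) else 0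

open MvPolynomial Equiv in
lemma pg_conj {α : Type} [Fintype α] [DecidableEq α] (k : ℕ) (g h : Perm α) :
    pg k (g * h * g⁻¹) = pg k h := by
  unfold pg
  refine Fintype.sum_equiv (Equiv.arrowCongr g.symm (Equiv.refl (Fin k))) _ _ ?_
  intro f
  have h1 : (∀ x, f ((g * h * g⁻¹) x) = f x) ↔ 
      ∀ x, (Equiv.arrowCongr g.symm (Equiv.refl (Fin k)) f) (h x) =
        (Equiv.arrowCongr g.symm (Equiv.refl (Fin k)) f) x := by
    simp only [Equiv.arrowCongr_apply, Function.comp, Equiv.symm_symm, Equiv.refl_apply,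
      Perm.mul_apply]
    constructor
    · intro h x
      simpa using h (g x)
    · intro h x
      simpa using h (g⁻¹ x)
  simp only [h1]
  congr 1
  exact (Fintype.prod_equiv g _ _ fun x => rfl).symm

open MvPolynomial Equiv in
lemma pg_rename {α : Type} [Fintype α] [DecidableEq α] (k : ℕ) (g : Perm α) (σ : Perm (Fin k)) :
    rename σ (pg k g) = pg k g := by
  unfold pg
  rw [map_sum]
  refine Fintype.sum_equiv (Equiv.arrowCongr (Equiv.refl α) σ) _ _ ?_
  intro f
  rw [apply_ite (rename σ)]
  simp [map_prod]

open MvPolynomial Equiv in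
lemma pg_one {α : Type} [Fintype α] [DecidableEq α] (k : ℕ) :
    pg k (1 : Perm α) = (∑ b, X b) ^ Fintype.card α := by
  unfold pg
  rw [← Finset.card_univ, ← Finset.prod_const, Finset.prod_univ_sum]
  simp

open MvPolynomial Equiv in
lemma pg_trans {α : Type} (i1 : Fintype α) (i2 : DecidableEq α) [Nonempty α] (k : ℕ) (g : Perm α)
    (hg : ∀ x y, g.SameCycle x y) :
    pg k g = ∑ b, X b ^ Fintype.card α := by
  unfold pg
  rw [← Finset.sum_filter]
  symm
  refine Finset.sum_bij (fun b _ => fun _ => b) ?_ ?_ ?_ ?_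
  · intro b _; simp
  · intro a _ b _ h
    exact congrFun h (Classical.arbitrary α)
  · intro f hf
    rw [Finset.mem_filter] at hf
    refine ⟨f (Classical.arbitrary α), Finset.mem_univ _, ?_⟩
    funext x
    obtain ⟨m, hm⟩ := (hg (Classical.arbitrary α) x).exists_nat_pow_eq
    have this : ∀ m : ℕ, f ((g ^ m) (Classical.arbitrary α)) = f (Classical.arbitrary α) := by
      intro m
      induction m with
      | zero => rfl
      | succ m ih => rw [pow_succ', Perm.mul_apply, hf.2, ih]
    rw [← hm]
    exact (this m).symm
  · intro b _
    simp

open MvPolynomial Equiv in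
lemma pg_mul {α : Type} [Fintype α] [DecidableEq α] (k : ℕ) (g : Perm α) (p : α → Prop)
    [DecidablePred p] (h1 : ∀ x, p (g x) ↔ p x) (h2 : ∀ x, ¬ p (g x) ↔ ¬ p x) :
    pg k g = pg k (g.subtypePerm (p := p) h1) * pg k (g.subtypePerm (p := fun x => ¬ p x) h2) := by
  unfold pg
  rw [Finset.sum_mul_sum, ← Finset.sum_product']
  refine Fintype.sum_equiv (Equiv.piEquivPiSubtypeProd p (fun _ => Fin k)) _ _ ?_
  intro f
  simp only [Equiv.piEquivPiSubtypeProd_apply, Perm.subtypePerm_apply]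
  rw [ite_zero_mul_ite_zero, Fintype.prod_subtype_mul_prod_subtype p (fun x => (X (f x) : MvPolynomial (Fin k) ℂ))]
  congr 1
  apply propext
  constructor
  · intro h; exact ⟨fun x => h x, fun x => h x⟩
  · rintro ⟨h, h'⟩ x
    by_cases hx : p x
    · exact h ⟨x, hx⟩
    · exact h' ⟨x, hx⟩

open MvPolynomial Equiv in
noncomputable def vd (k : ℕ) : MvPolynomial (Fin k) ℂ := (Matrix.vandermonde (fun i : Fin k => X i)).det

open MvPolynomial Equiv in
lemma vd_rename (k : ℕ) (σ : Perm (Fin k)) :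
    rename σ (vd k) = ((Perm.sign σ : ℤ) : MvPolynomial (Fin k) ℂ) * vd k := by
  unfold vd
  rw [← Matrix.det_permute, AlgHom.map_det]
  congr 1
  ext i j
  simp [Matrix.vandermonde]

open MvPolynomial Equiv in
lemma coeff_anti {k : ℕ} (A : MvPolynomial (Fin k) ℂ)
    (hA : ∀ σ : Perm (Fin k), rename σ A = ((Perm.sign σ : ℤ) : MvPolynomial (Fin k) ℂ) * A)
    (e : Fin k →₀ ℕ) (a b : Fin k) (hab : a ≠ b) (he : e a = e b) : coeff e A = 0 := by
  have h1 := coeff_rename_mapDomain (swap a b) (swap a b).injective A e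
  have h2 : e.mapDomain (swap a b) = e := by
    ext x
    rw [← Finsupp.equivMapDomain_eq_mapDomain, Finsupp.equivMapDomain_apply, symm_swap]
    by_cases hxa : x = a
    · subst hxa; rw [swap_apply_left, he]
    by_cases hxb : x = b
    · subst hxb; rw [swap_apply_right, he]
    rw [swap_apply_of_ne_of_ne hxa hxb]
  rw [h2, hA, Perm.sign_swap hab] at h1
  simp at h1
  linear_combination (-1/2 : ℂ) * h1

/-- the staircase exponent -/
noncomputable def lst (k : ℕ) : Fin k →₀ ℕ := Finsupp.equivFunOnFinite.symm (fun i => 2 * (i : ℕ) + 1)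

open MvPolynomial Equiv in
noncomputable def FF (k : ℕ) {n : ℕ} (g : Perm (Fin n)) : ℂ := coeff (lst k) (vd k * pg k g)

lemma exists_even_cycle {n : ℕ} (g : Equiv.Perm (Fin n)) (hg : 2 ∣ orderOf g) :
    ∃ c ∈ g.cycleFactorsFinset, 2 ∣ c.support.card := by
  rw [← Equiv.Perm.lcm_cycleType] at hg
  have h1 : g.cycleType.lcm ∣ g.cycleType.prod := Multiset.lcm_dvd.2 fun a ha => Multiset.dvd_prod ha
  obtain ⟨a, ha, h2⟩ := Prime.exists_mem_multiset_dvd Nat.prime_two.prime (hg.trans h1)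
  rw [Equiv.Perm.cycleType_def, Multiset.mem_map] at ha
  obtain ⟨c, hc, rfl⟩ := ha
  exact ⟨c, hc, h2⟩

open MvPolynomial Equiv in
lemma pg_cycle {n : ℕ} (k : ℕ) (g c : Perm (Fin n)) (hc : c ∈ g.cycleFactorsFinset)
    (h2 : ∀ x, ¬ (g x ∈ c.support) ↔ ¬ (x ∈ c.support)) :
    pg k g = (∑ b, X b ^ c.support.card) * pg k (g.subtypePerm (p := fun x => ¬ (x ∈ c.support)) h2) := by
  have hcc := Perm.mem_cycleFactorsFinset_iff.1 hc
  have h1 : ∀ x, g x ∈ c.support ↔ x ∈ c.support := fun x => not_iff_not.1 (h2 x)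
  rw [pg_mul k g (fun x => x ∈ c.support) h1 h2]
  congr 1
  have hne : Nonempty {x // x ∈ c.support} := by
    obtain ⟨x, hx⟩ := hcc.1.nonempty_support
    exact ⟨⟨x, hx⟩⟩
  have hcard : Fintype.card {x // x ∈ c.support} = c.support.card := Fintype.card_coe _
  refine (pg_trans _ _ k _ ?_).trans ?_
  rotate_left
  · refine Finset.sum_congr rfl fun b _ => ?_
    congr 1
    rw [← hcard]
    rw [Fintype.card_eq_nat_card, Fintype.card_eq_nat_card]
  · rintro ⟨x, hx⟩ ⟨y, hy⟩
    rw [Perm.sameCycle_subtypePerm]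
    have := hcc.1.sameCycle (Perm.mem_support.1 hx) (Perm.mem_support.1 hy)
    obtain ⟨m, hm⟩ := this.exists_nat_pow_eq
    refine ⟨m, ?_⟩
    simp only [zpow_natCast]
    rw [← hm]
    have : ∀ m : ℕ, (g ^ m) x = (c ^ m) x := by
      intro m
      induction m with
      | zero => rfl
      | succ m ih =>
        rw [pow_succ', Perm.mul_apply, ih, pow_succ', Perm.mul_apply]
        exact (hcc.2 _ (Perm.pow_apply_mem_support.2 hx)).symm
    exact this m

lemma cycle_inv {n : ℕ} (g c : Equiv.Perm (Fin n)) (hc : c ∈ g.cycleFactorsFinset) :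
    ∀ x, ¬ (g x ∈ c.support) ↔ ¬ (x ∈ c.support) := by
  intro x
  rw [not_iff_not]
  exact Equiv.Perm.mem_cycleFactorsFinset_support hc x

open MvPolynomial Equiv in
lemma coeff_mul_psum {k : ℕ} (A : MvPolynomial (Fin k) ℂ) (e : Fin k →₀ ℕ) (m : ℕ) :
    coeff e (A * ∑ b, X b ^ m) =
      ∑ b, if m ≤ e b then coeff (e - Finsupp.single b m) A else 0 := by
  rw [Finset.mul_sum, coeff_sum]
  refine Finset.sum_congr rfl fun b _ => ?_
  rw [X_pow_eq_monomial, coeff_mul_monomial']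
  simp only [Finsupp.single_le_iff, mul_one]

open MvPolynomial Equiv in
lemma FF_even (k : ℕ) {n : ℕ} (g : Perm (Fin n)) (hg : 2 ∣ orderOf g) : FF k g = 0 := by
  obtain ⟨c, hc, m, hm⟩ := exists_even_cycle g hg
  unfold FF
  rw [pg_cycle k g c hc (cycle_inv g c hc), mul_comm (∑ b, _), ← mul_assoc, coeff_mul_psum]
  apply Finset.sum_eq_zero
  intro b _
  split_ifs with h
  · rw [hm] at h ⊢
    have hm0 : m ≠ 0 := by
      rintro rfl
      have := (Perm.mem_cycleFactorsFinset_iff.1 hc).1.two_le_card_support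
      omega
    have hl : ∀ i, lst k i = 2 * (i : ℕ) + 1 := fun i => rfl
    rw [hl] at h
    have hb : m ≤ (b : ℕ) := by omega
    refine coeff_anti _ ?_ _ b ⟨b - m, by omega⟩ ?_ ?_
    · intro σ
      rw [map_mul, pg_rename, vd_rename, mul_assoc]
    · intro h'
      have := congrArg Fin.val h'
      simp at this
      omega
    · rw [Finsupp.tsub_apply, Finsupp.tsub_apply, hl, hl, Finsupp.single_eq_same, Finsupp.single_eq_of_ne]
      · simp; omega
      · intro h'
        have := congrArg Fin.val h'
        simp at this
        omega
  · rfl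


open MvPolynomial Equiv in
noncomputable def th {k : ℕ} (a : Fin k) (p : MvPolynomial (Fin k) ℂ) : MvPolynomial (Fin k) ℂ :=
  X a * pderiv a p

open MvPolynomial Equiv in
lemma th_add {k : ℕ} (a : Fin k) (p q : MvPolynomial (Fin k) ℂ) : th a (p + q) = th a p + th a q := by
  simp [th, mul_add]

open MvPolynomial Equiv in
lemma th_sum {k : ℕ} (a : Fin k) {ι : Type*} (s : Finset ι) (p : ι → MvPolynomial (Fin k) ℂ) :
    th a (∑ i ∈ s, p i) = ∑ i ∈ s, th a (p i) := by
  simp [th, Finset.mul_sum]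

open MvPolynomial Equiv in
lemma th_mul {k : ℕ} (a : Fin k) (p q : MvPolynomial (Fin k) ℂ) :
    th a (p * q) = th a p * q + p * th a q := by
  simp [th, Derivation.leibniz]; ring

open MvPolynomial Equiv in
lemma th_monomial {k : ℕ} (a : Fin k) (s : Fin k →₀ ℕ) (c : ℂ) :
    th a (monomial s c) = monomial s ((s a : ℂ) * c) := by
  unfold th
  rw [pderiv_monomial, X, monomial_mul]
  by_cases h : s a = 0
  · simp [h]
  · congr 1
    · rw [add_tsub_cancel_of_le]
      rw [Finsupp.single_le_iff]; omega
    · ring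

open MvPolynomial Equiv in
lemma coeff_th {k : ℕ} (a : Fin k) (s : Fin k →₀ ℕ) (p : MvPolynomial (Fin k) ℂ) :
    coeff s (th a p) = (s a : ℂ) * coeff s p := by
  induction p using MvPolynomial.induction_on' with
  | monomial u c =>
    rw [th_monomial, coeff_monomial, coeff_monomial]
    split_ifs with h
    · rw [h]
    · simp
  | add p q hp hq => rw [th_add, coeff_add, coeff_add, hp, hq]; ring

open MvPolynomial Equiv in
lemma mon_eq {α : Type} [Fintype α] {k : ℕ} (f : α → Fin k) :
    (∏ x, X (f x) : MvPolynomial (Fin k) ℂ) = monomial (∑ x, Finsupp.single (f x) 1) 1 := by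
  rw [monomial_sum_one]
  rfl

open MvPolynomial Equiv in
lemma th_mon {α : Type} [Fintype α] {k : ℕ} (a : Fin k) (f : α → Fin k) :
    th a (∏ x, X (f x) : MvPolynomial (Fin k) ℂ) = ∑ i, if f i = a then ∏ x, X (f x) else 0 := by
  rw [mon_eq, th_monomial, Finsupp.finsetSum_apply]
  rw [← Finset.sum_filter, Finset.sum_const]
  simp only [Finsupp.single_apply]
  rw [← Finset.sum_filter, Finset.sum_const, nsmul_eq_mul, mul_one, smul_monomial]
  simp

open MvPolynomial Equiv in
lemma th_ite {k : ℕ} (a : Fin k) (P : Prop) [Decidable P] (p : MvPolynomial (Fin k) ℂ) :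
    th a (if P then p else 0) = if P then th a p else 0 := by
  split_ifs <;> simp [th]

open MvPolynomial Equiv in
lemma th_pg {α : Type} [Fintype α] [DecidableEq α] {k : ℕ} (a : Fin k) (g : Perm α) :
    th a (pg k g) = ∑ i, ∑ f : α → Fin k,
      if (f i = a ∧ ∀ x, f (g x) = f x) then ∏ x, X (f x) else 0 := by
  unfold pg
  rw [th_sum, Finset.sum_comm]
  refine Finset.sum_congr rfl fun f _ => ?_
  rw [th_ite, th_mon]
  by_cases h : ∀ x, f (g x) = f x
  · simp [h]
  · simp [h]

open MvPolynomial Equiv in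
lemma th_th_pg {α : Type} [Fintype α] [DecidableEq α] {k : ℕ} (a : Fin k) (g : Perm α) :
    th a (th a (pg k g)) = ∑ i, ∑ j, ∑ f : α → Fin k,
      if (f i = a ∧ f j = a ∧ ∀ x, f (g x) = f x) then ∏ x, X (f x) else 0 := by
  rw [th_pg, th_sum]
  refine Finset.sum_congr rfl fun i _ => ?_
  rw [th_sum, Finset.sum_comm]
  refine Finset.sum_congr rfl fun f _ => ?_
  rw [th_ite, th_mon]
  by_cases h : f i = a ∧ ∀ x, f (g x) = f x
  · simp [h]
  · rw [if_neg h]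
    symm
    apply Finset.sum_eq_zero
    intro j _
    rw [if_neg]
    tauto

open MvPolynomial Equiv in
lemma sum_th_pg {α : Type} [Fintype α] [DecidableEq α] {k : ℕ} (g : Perm α) :
    ∑ a, th a (pg k g) = (Fintype.card α : MvPolynomial (Fin k) ℂ) * pg k g := by
  simp only [th_pg]
  rw [Finset.sum_comm]
  have : ∀ i : α, (∑ a : Fin k, ∑ f : α → Fin k,
      if (f i = a ∧ ∀ x, f (g x) = f x) then (∏ x, X (f x) : MvPolynomial (Fin k) ℂ) else 0) = pg k g := by
    intro i
    rw [Finset.sum_comm]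
    unfold pg
    refine Finset.sum_congr rfl fun f _ => ?_
    by_cases h : ∀ x, f (g x) = f x
    · simp [h]
    · simp [h]
  simp [this]

open MvPolynomial Equiv in
noncomputable def ZZ {α : Type} [Fintype α] [DecidableEq α] {k : ℕ} (g : Perm α) (a b : Fin k) :
    MvPolynomial (Fin k) ℂ :=
  ∑ i, ∑ j, ∑ f : α → Fin k,
      if (f i = a ∧ f j = b ∧ ∀ x, f (swap i j (g x)) = f x) then ∏ x, X (f x) else 0

open MvPolynomial Equiv in
noncomputable def YY {α : Type} [Fintype α] [DecidableEq α] {k : ℕ} (g : Perm α) (a b : Fin k) :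
    MvPolynomial (Fin k) ℂ :=
  ∑ i, ∑ j, ∑ f : α → Fin k,
      if (f i = a ∧ Function.update f i b j = b ∧
        ∀ x, Function.update (Function.update f i b) j a (g x) = f x) then ∏ x, X (f x) else 0

open MvPolynomial Equiv in
lemma ZZ_sum {α : Type} [Fintype α] [DecidableEq α] {k : ℕ} (g : Perm α) :
    ∑ a : Fin k, ∑ b : Fin k, ZZ g a b = ∑ i, ∑ j, pg k (swap i j * g) := by
  have h1 : ∀ i j : α, (∑ a : Fin k, ∑ b : Fin k, ∑ f : α → Fin k,
      if (f i = a ∧ f j = b ∧ ∀ x, f (swap i j (g x)) = f x) then (∏ x, X (f x) : MvPolynomial (Fin k) ℂ) else 0)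
      = pg k (swap i j * g) := by
    intro i j
    unfold pg
    have : ∀ a : Fin k, (∑ b : Fin k, ∑ f : α → Fin k,
      if (f i = a ∧ f j = b ∧ ∀ x, f (swap i j (g x)) = f x) then (∏ x, X (f x) : MvPolynomial (Fin k) ℂ) else 0)
      = ∑ f : α → Fin k, ∑ b : Fin k, 
      if (f i = a ∧ f j = b ∧ ∀ x, f (swap i j (g x)) = f x) then (∏ x, X (f x) : MvPolynomial (Fin k) ℂ) else 0 :=
      fun a => Finset.sum_comm
    simp only [this]
    rw [Finset.sum_comm]
    refine Finset.sum_congr rfl fun f _ => ?_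
    simp only [ite_and, Finset.sum_ite_irrel, Finset.sum_ite_eq, Finset.mem_univ, Finset.sum_const_zero, if_true, Perm.mul_apply]
    congr
  simp only [← h1]
  unfold ZZ
  have h2 : ∀ F : Fin k → α → α → MvPolynomial (Fin k) ℂ, 
     ∑ b, ∑ i, ∑ j, F b i j = ∑ i, ∑ j, ∑ b, F b i j := by
    intro F
    rw [Finset.sum_comm]
    exact Finset.sum_congr rfl fun i _ => Finset.sum_comm
  simp only [h2]

open MvPolynomial Equiv in
lemma ZZ_comm {α : Type} [Fintype α] [DecidableEq α] {k : ℕ} (g : Perm α) (a b : Fin k) :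
    ZZ g a b = ZZ g b a := by
  unfold ZZ
  rw [Finset.sum_comm]
  refine Finset.sum_congr rfl fun i _ => Finset.sum_congr rfl fun j _ => Finset.sum_congr rfl fun f _ => ?_
  rw [swap_comm j i]
  congr 1
  apply propext
  tauto

open MvPolynomial Equiv in
lemma ZZ_diag {α : Type} [Fintype α] [DecidableEq α] {k : ℕ} (g : Perm α) (a : Fin k) :
    ZZ g a a = th a (th a (pg k g)) := by
  rw [th_th_pg]
  unfold ZZ
  refine Finset.sum_congr rfl fun i _ => Finset.sum_congr rfl fun j _ => Finset.sum_congr rfl fun f _ => ?_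
  congr 1
  apply propext
  refine and_congr_right fun h1 => and_congr_right fun h2 => ?_
  have : ∀ y, f (swap i j y) = f y := by
    intro y
    rw [swap_apply_def]
    split_ifs with h h'
    · rw [h, h1, h2]
    · rw [h', h1, h2]
    · rfl
  simp only [this]

open MvPolynomial Equiv in
lemma YY_eq {α : Type} [Fintype α] [DecidableEq α] {k : ℕ} (g : Perm α) (a b : Fin k) (hab : a ≠ b) :
    YY g a b = ZZ g a b + th a (pg k g) := by
  rw [th_pg]
  unfold YY ZZ
  rw [← Finset.sum_add_distrib]
  refine Finset.sum_congr rfl fun i _ => ?_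
  have : (∑ f : α → Fin k,
      if (f i = a ∧ ∀ x, f (g x) = f x) then (∏ x, X (f x) : MvPolynomial (Fin k) ℂ) else 0) = 
      ∑ j, if j = i then ∑ f : α → Fin k,
      if (f i = a ∧ ∀ x, f (g x) = f x) then (∏ x, X (f x) : MvPolynomial (Fin k) ℂ) else 0 else 0 := by
    simp
  rw [this, ← Finset.sum_add_distrib]
  refine Finset.sum_congr rfl fun j _ => ?_
  by_cases hij : j = i
  · subst hij
    rw [if_pos rfl]
    have h0 : ∀ f : α → Fin k, ¬ (f j = a ∧ f j = b ∧ ∀ x, f (swap j j (g x)) = f x) := by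
      rintro f ⟨h1, h2, _⟩
      exact hab (h1.symm.trans h2)
    simp only [h0, if_false, Finset.sum_const_zero, zero_add]
    refine Finset.sum_congr rfl fun f _ => ?_
    congr 1
    apply propext
    refine and_congr_right fun h1 => ?_
    have : Function.update (Function.update f j b) j a = f := by
      rw [Function.update_idem, ← h1, Function.update_eq_self]
    rw [this]
    simp
  · rw [if_neg hij, add_zero]
    refine Finset.sum_congr rfl fun f _ => ?_
    congr 1
    apply propext
    refine and_congr_right fun h1 => ?_
    rw [Function.update_of_ne hij]
    refine and_congr_right fun h2 => ?_
    have : Function.update (Function.update f i b) j a = fun y => f (swap i j y) := by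
      funext y
      by_cases hy : y = j
      · subst hy; simp [h1]
      rw [Function.update_of_ne hy]
      by_cases hy' : y = i
      · subst hy'; simp [h2]
      rw [Function.update_of_ne hy', swap_apply_of_ne_of_ne hy' hy]
    rw [this]

open MvPolynomial Equiv in
lemma mon_update {α : Type} [Fintype α] [DecidableEq α] {k : ℕ} (f : α → Fin k) (i : α) (a b : Fin k)
    (h : f i = a) : (X a * ∏ x, X (Function.update f i b x) : MvPolynomial (Fin k) ℂ) =
      X b * ∏ x, X (f x) := by
  rw [← Finset.mul_prod_erase _ _ (Finset.mem_univ i), ← Finset.mul_prod_erase _ (fun x => X (f x)) (Finset.mem_univ i),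
    Function.update_self, h]
  rw [Finset.prod_congr rfl (g := fun x => X (f x))]
  · ring
  · intro x hx
    rw [Function.update_of_ne (Finset.ne_of_mem_erase hx)]

open MvPolynomial Equiv in
lemma YY_swap {α : Type} [Fintype α] [DecidableEq α] {k : ℕ} (g : Perm α) (a b : Fin k) :
    X b * YY g a b = X a * YY g b a := by
  have conv : ∀ F : α → α → (α → Fin k) → MvPolynomial (Fin k) ℂ,
      ∑ i, ∑ j, ∑ f, F i j f = ∑ t : α × α × (α → Fin k), F t.1 t.2.1 t.2.2 := by
    intro F
    rw [Fintype.sum_prod_type]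
    refine Finset.sum_congr rfl fun i _ => ?_
    rw [Fintype.sum_prod_type]
  unfold YY
  rw [conv, conv, ← Finset.sum_filter, ← Finset.sum_filter, Finset.mul_sum, Finset.mul_sum]
  refine Finset.sum_bij' (fun t _ => (t.2.1, g t.1, Function.update t.2.2 t.1 b))
    (fun t _ => (g⁻¹ t.2.1, t.1, Function.update t.2.2 (g⁻¹ t.2.1) a)) ?_ ?_ ?_ ?_ ?_
  · rintro ⟨i, j, f⟩ h
    rw [Finset.mem_filter] at h ⊢
    obtain ⟨_, h1, h2, h3⟩ := h
    dsimp only at h1 h2 h3 ⊢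
    refine ⟨Finset.mem_univ _, h2, by rw [h3, h1], ?_⟩
    intro x
    by_cases hx : x = i
    · subst hx; simp
    · rw [Function.update_of_ne (fun h => hx (g.injective h)), h3, Function.update_of_ne hx]
  · rintro ⟨i, j, f⟩ h
    rw [Finset.mem_filter] at h ⊢
    obtain ⟨_, h1, h2, h3⟩ := h
    dsimp only at h1 h2 h3 ⊢
    have hb : f (g⁻¹ j) = b := by
      rw [← h3]; simp
    have hu : Function.update (Function.update f (g⁻¹ j) a) (g⁻¹ j) b = f := by
      rw [Function.update_idem, ← hb, Function.update_eq_self]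
    refine ⟨Finset.mem_univ _, by simp, by rw [hu, h1], ?_⟩
    intro x
    rw [hu]
    by_cases hx : x = g⁻¹ j
    · subst hx; simp [h2]
    · have hne : g x ≠ j := by
        intro h; apply hx; rw [← h]; simp
      have h4 := h3 x
      rw [Function.update_of_ne hne] at h4
      rw [Function.update_of_ne hx, h4]
  · rintro ⟨i, j, f⟩ h
    rw [Finset.mem_filter] at h
    obtain ⟨_, h1, h2, h3⟩ := h
    dsimp only at h1 h2 h3 ⊢
    simp [← h1]
  · rintro ⟨i, j, f⟩ h
    rw [Finset.mem_filter] at h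
    obtain ⟨_, h1, h2, h3⟩ := h
    dsimp only at h1 h2 h3 ⊢
    have hb : f (g⁻¹ j) = b := by
      rw [← h3]; simp
    have hu : Function.update (Function.update f (g⁻¹ j) a) (g⁻¹ j) b = f := by
      rw [Function.update_idem, ← hb, Function.update_eq_self]
    rw [hu]; simp
  · rintro ⟨i, j, f⟩ h
    rw [Finset.mem_filter] at h
    obtain ⟨_, h1, h2, h3⟩ := h
    exact (mon_update f i a b h1).symm

open MvPolynomial Equiv in
lemma ZZ_rel {α : Type} [Fintype α] [DecidableEq α] {k : ℕ} (g : Perm α) (a b : Fin k) (hab : a ≠ b) :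
    (X a - X b) * ZZ g a b = X b * th a (pg k g) - X a * th b (pg k g) := by
  have := YY_swap g a b
  rw [YY_eq g a b hab, YY_eq g b a hab.symm, ← ZZ_comm g a b] at this
  linear_combination -this

open MvPolynomial Equiv in
lemma deriv_prod_eigen {k : ℕ} {ι : Type*} (D : MvPolynomial (Fin k) ℂ → MvPolynomial (Fin k) ℂ)
    (h1 : D 1 = 0) (hD : ∀ p q, D (p * q) = D p * q + p * D q) (s : Finset ι)
    (u v : ι → MvPolynomial (Fin k) ℂ) (huv : ∀ i ∈ s, D (u i) = u i * v i) :
    D (∏ i ∈ s, u i) = (∏ i ∈ s, u i) * ∑ i ∈ s, v i := by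
  classical
  induction s using Finset.induction_on with
  | empty => simp [h1]
  | insert a s ha ih =>
    rw [Finset.prod_insert ha, Finset.sum_insert ha, hD, ih fun i hi => huv i (Finset.mem_insert_of_mem hi),
      huv a (Finset.mem_insert_self _ _)]
    ring

open MvPolynomial Equiv in
lemma th_X_self {k : ℕ} (a b : Fin k) : th a (X b : MvPolynomial (Fin k) ℂ) = if b = a then X a else 0 := by
  unfold th
  rw [pderiv_X, Pi.single_apply]
  simp

open MvPolynomial Equiv in
lemma sum_th_vd {α : Type} [Fintype α] [DecidableEq α] {k : ℕ} (g : Perm α) :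
    ∑ a, th a (vd k) * th a (pg k g) = vd k * ∑ i : Fin k, ∑ j ∈ Finset.Ioi i,
      (th j (pg k g) + th i (pg k g) + ZZ g j i) := by
  unfold vd
  rw [Matrix.det_vandermonde]
  set D : MvPolynomial (Fin k) ℂ → MvPolynomial (Fin k) ℂ := fun q => ∑ a, th a q * th a (pg k g) with hD
  have h1 : D 1 = 0 := by simp [hD, th]
  have h2 : ∀ p q, D (p * q) = D p * q + p * D q := by
    intro p q
    simp only [hD, th_mul, Finset.sum_mul, Finset.mul_sum]
    rw [← Finset.sum_add_distrib]
    exact Finset.sum_congr rfl fun _ _ => by ring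
  refine deriv_prod_eigen D h1 h2 _ _ _ ?_
  intro i _
  refine deriv_prod_eigen D h1 h2 _ _ _ ?_
  intro j hj
  have hij : j ≠ i := (Finset.mem_Ioi.1 hj).ne'
  have h3 : D (X j - X i) = X j * th j (pg k g) - X i * th i (pg k g) := by
    have : ∀ a, th a (X j - X i : MvPolynomial (Fin k) ℂ) = th a (X j) - th a (X i) := by
      intro a; simp [th, mul_sub]
    simp only [hD, this, th_X_self, sub_mul, Finset.sum_sub_distrib, ite_mul, zero_mul]
    simp
  rw [h3]
  have := ZZ_rel g j i hij
  linear_combination -this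

open MvPolynomial Equiv in
lemma two_sum_th_vd {α : Type} [Fintype α] [DecidableEq α] {k : ℕ} (g : Perm α) :
    2 * ∑ a, th a (vd k) * th a (pg k g) = vd k * (∑ i : Fin k, ∑ j, ZZ g i j - ∑ i : Fin k, ZZ g i i 
      + 2 * ((k : MvPolynomial (Fin k) ℂ) - 1) * ((Fintype.card α : MvPolynomial (Fin k) ℂ) * pg k g)) := by
  rw [sum_th_vd, mul_left_comm]
  congr 1
  set F : Fin k → Fin k → MvPolynomial (Fin k) ℂ := fun i j => th j (pg k g) + th i (pg k g) + ZZ g j i with hF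
  have hFs : ∀ i j, F i j = F j i := by
    intro i j
    simp only [hF]; rw [ZZ_comm]; ring
  have h1 : 2 * ∑ i : Fin k, ∑ j ∈ Finset.Ioi i, F i j = ∑ i : Fin k, ∑ j ∈ Finset.Ioi i, (F j i + F i j) := by
    rw [Finset.mul_sum]
    refine Finset.sum_congr rfl fun i _ => ?_
    rw [Finset.mul_sum]
    refine Finset.sum_congr rfl fun j _ => ?_
    rw [hFs j i]; ring
  rw [h1, Finset.sum_sum_Ioi_add_eq_sum_sum_off_diag]
  have h2 : ∀ i, ∑ j ∈ {i}ᶜ, F j i = (∑ j, F j i) - F i i := by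
    intro i
    rw [eq_sub_iff_add_eq, ← Finset.sum_compl_add_sum {i}]
    simp
  rw [Finset.sum_congr rfl fun i _ => h2 i]
  simp only [hF, Finset.sum_sub_distrib, Finset.sum_add_distrib]
  simp only [Finset.sum_const, Finset.card_univ, Fintype.card_fin, ← Finset.smul_sum, sum_th_pg]
  simp only [nsmul_eq_mul]
  ring

open MvPolynomial Equiv in
lemma vd_eigen (k : ℕ) : ∃ K : ℂ, ∑ a, th a (th a (vd k)) = C K * vd k := by
  refine ⟨∑ i : Fin k, ((i : ℕ) : ℂ) ^ 2, ?_⟩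
  unfold vd
  rw [Matrix.det_apply']
  simp only [th_sum]
  rw [Finset.sum_comm, Finset.mul_sum]
  refine Finset.sum_congr rfl fun σ _ => ?_
  have h1 : (((Perm.sign σ : ℤ) : MvPolynomial (Fin k) ℂ) * ∏ i, Matrix.vandermonde (fun i : Fin k => (X i : MvPolynomial (Fin k) ℂ)) (σ i) i)
     = monomial (∑ i : Fin k, Finsupp.single (σ i) (i : ℕ)) ((Perm.sign σ : ℤ) : ℂ) := by
    have h2 : ∀ i : Fin k, (X (σ i) : MvPolynomial (Fin k) ℂ) ^ (i : ℕ) = monomial (Finsupp.single (σ i) (i : ℕ)) 1 :=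
      fun i => X_pow_eq_monomial
    simp only [Matrix.vandermonde_apply, h2]
    rw [← monomial_sum_one]
    have h3 : ((Perm.sign σ : ℤ) : MvPolynomial (Fin k) ℂ) = C ((Perm.sign σ : ℤ) : ℂ) := by simp
    rw [h3, C_mul_monomial, mul_one]
  rw [h1]
  simp only [th_monomial]
  rw [C_mul_monomial, ← map_sum, Finset.sum_mul]
  congr 1
  rw [← Equiv.sum_comp σ]
  refine Finset.sum_congr rfl fun i _ => ?_
  have : (∑ j : Fin k, Finsupp.single (σ j) (j : ℕ)) (σ i) = (i : ℕ) := by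
    rw [Finsupp.finsetSum_apply]
    simp [Finsupp.single_apply]
  rw [this]; ring

open MvPolynomial Equiv in
lemma FF_T (k n : ℕ) : ∃ c : ℂ, ∀ g : Perm (Fin n), ∑ i, ∑ j, FF k (swap i j * g) = c * FF k g := by
  obtain ⟨K, hK⟩ := vd_eigen k
  refine ⟨∑ a : Fin k, (lst k a : ℂ) ^ 2 - (K + 2 * ((k : ℂ) - 1) * n), fun g => ?_⟩
  have h1 : ∑ a, th a (th a (vd k * pg k g)) = vd k * ∑ i, ∑ j, pg k (swap i j * g) + 
      C (K + 2 * ((k : ℂ) - 1) * n) * (vd k * pg k g) := by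
    have h2 : ∀ a, th a (th a (vd k * pg k g)) = th a (th a (vd k)) * pg k g + 2 * (th a (vd k) * th a (pg k g))
        + vd k * th a (th a (pg k g)) := by
      intro a
      simp only [th_mul, th_add]; ring
    simp only [h2, Finset.sum_add_distrib, ← Finset.sum_mul, ← Finset.mul_sum, hK, two_sum_th_vd, ZZ_sum, ← ZZ_diag]
    have hC : (C 2 : MvPolynomial (Fin k) ℂ) = 2 := map_ofNat C 2
    simp [hC]
    ring
  have h3 := congrArg (coeff (lst k)) h1
  rw [coeff_add, coeff_C_mul, coeff_sum] at h3
  simp only [coeff_th, Finset.mul_sum, coeff_sum] at h3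
  unfold FF
  rw [sub_mul, Finset.sum_mul, eq_sub_iff_add_eq, ← h3]
  refine Finset.sum_congr rfl fun i _ => ?_
  ring


open MvPolynomial Equiv in
lemma vd_expand (k : ℕ) : vd k = ∑ σ : Perm (Fin k),
    monomial (∑ i : Fin k, Finsupp.single (σ i) (i : ℕ)) ((Perm.sign σ : ℤ) : ℂ) := by
  unfold vd
  rw [Matrix.det_apply']
  refine Finset.sum_congr rfl fun σ _ => ?_
  have h2 : ∀ i : Fin k, (X (σ i) : MvPolynomial (Fin k) ℂ) ^ (i : ℕ) = monomial (Finsupp.single (σ i) (i : ℕ)) 1 :=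
    fun i => X_pow_eq_monomial
  simp only [Matrix.vandermonde_apply, h2]
  rw [← monomial_sum_one]
  have h3 : ((Perm.sign σ : ℤ) : MvPolynomial (Fin k) ℂ) = C ((Perm.sign σ : ℤ) : ℂ) := by simp
  rw [h3, C_mul_monomial, mul_one]

open MvPolynomial Equiv in
lemma coeff_pow_sum {k : ℕ} (d : Fin k →₀ ℕ) (N : ℕ) (hd : ∑ i, d i = N) :
    coeff d ((∑ b, X b : MvPolynomial (Fin k) ℂ) ^ N) * ∏ i, ((d i).factorial : ℂ) = (N.factorial : ℂ) := by
  rw [coeff_sum_X_pow_of_fintype, Finsupp.multinomial_eq]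
  have h1 : (d.sum fun _ m => m) = N := by
    rw [← hd]; exact Finsupp.sum_fintype _ _ (by simp)
  rw [if_pos h1]
  have h2 := Nat.multinomial_spec d.support d
  have h3 : ∏ i ∈ d.support, (d i).factorial = ∏ i, (d i).factorial :=
    Finset.prod_subset (Finset.subset_univ _) fun i _ hi => by
      rw [Finsupp.notMem_support_iff.1 hi]; rfl
  have h4 : ∑ i ∈ d.support, d i = N := h1
  rw [h3, h4] at h2
  rw [← h2]
  push_cast
  ring

open MvPolynomial Equiv in
lemma coeff_vd_pow {k : ℕ} (e : Fin k →₀ ℕ) (N : ℕ) (he : ∑ i, e i = N + ∑ i : Fin k, (i : ℕ)) :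
    coeff e (vd k * (∑ b, X b) ^ N) * ∏ i, ((e i).factorial : ℂ) =
      (N.factorial : ℂ) * (Matrix.vandermonde fun i => (e i : ℂ)).det := by
  have hdet := Matrix.det_eval_matrixOfPolynomials_eq_det_vandermonde (fun i => (e i : ℂ))
      (fun i : Fin k => descPochhammer ℂ i)
      (fun i => descPochhammer_natDegree ℂ i)
      (fun i => monic_descPochhammer ℂ i)
  rw [hdet, Matrix.det_apply', vd_expand, Finset.sum_mul, coeff_sum, Finset.sum_mul, Finset.mul_sum]
  refine Finset.sum_congr rfl fun σ _ => ?_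
  simp only [Matrix.of_apply, descPochhammer_eval_eq_descFactorial]
  set s : Fin k →₀ ℕ := ∑ i : Fin k, Finsupp.single (σ i) (i : ℕ) with hs
  have hsi : ∀ i, s (σ i) = (i : ℕ) := by
    intro i
    rw [hs, Finsupp.finsetSum_apply]
    simp [Finsupp.single_apply]
  rw [coeff_monomial_mul']
  split_ifs with hle
  · have h1 : ∑ i, (e - s) i = N := by
      have : ∑ i, (e - s) i + ∑ i, s i = ∑ i, e i := by
        rw [← Finset.sum_add_distrib]
        refine Finset.sum_congr rfl fun i _ => ?_
        rw [Finsupp.tsub_apply]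
        exact Nat.sub_add_cancel (hle i)
      have h2 : ∑ i, s i = ∑ i : Fin k, (i : ℕ) := by
        rw [← Equiv.sum_comp σ]; simp [hsi]
      omega
    have h3 := coeff_pow_sum (e - s) N h1
    rw [← h3]
    have h4 : ∏ i, ((e i).factorial : ℂ) = (∏ i, (((e - s) i).factorial : ℂ)) * ∏ i, ((e (σ i)).descFactorial i : ℂ) := by
      rw [← Equiv.prod_comp σ, ← Equiv.prod_comp σ (fun i => (((e - s) i).factorial : ℂ)), ← Finset.prod_mul_distrib]
      refine Finset.prod_congr rfl fun i _ => ?_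
      rw [Finsupp.tsub_apply, hsi, ← Nat.cast_mul, Nat.factorial_mul_descFactorial]
      have := hle (σ i)
      rwa [hsi] at this
    rw [h4]; ring
  · have : ∃ i, e (σ i) < (i : ℕ) := by
      by_contra hcon
      push Not at hcon
      apply hle
      intro j
      have := hcon (σ.symm j)
      rw [← hsi] at this
      simpa using this
    obtain ⟨i, hi⟩ := this
    have : ∏ i, ((e (σ i)).descFactorial i : ℂ) = 0 := by
      apply Finset.prod_eq_zero (Finset.mem_univ i)
      rw [Nat.descFactorial_eq_zero_iff_lt.2 hi]; simp
    rw [this]; ring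

lemma vand_split {k : ℕ} (w : Fin k → ℂ) (b : Fin k) :
    (Matrix.vandermonde w).det =
      (∏ i ∈ Finset.univ.erase b, ∏ j ∈ (Finset.Ioi i).erase b, (w j - w i)) *
      (∏ i ∈ Finset.univ.erase b, if b < i then (-1 : ℂ) else 1) *
      ∏ i ∈ Finset.univ.erase b, (w b - w i) := by
  rw [Matrix.det_vandermonde, ← Finset.mul_prod_erase _ _ (Finset.mem_univ b)]
  have h1 : ∏ j ∈ Finset.Ioi b, (w j - w b) = ∏ i ∈ Finset.univ.erase b, if b < i then w i - w b else 1 := by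
    rw [← Finset.prod_filter]
    apply Finset.prod_congr _ fun _ _ => rfl
    ext i
    simp only [Finset.mem_Ioi, Finset.mem_filter, Finset.mem_erase, Finset.mem_univ, and_true]
    constructor
    · intro h; exact ⟨h.ne', h⟩
    · exact fun h => h.2
  rw [h1, ← Finset.prod_mul_distrib, ← Finset.prod_mul_distrib, ← Finset.prod_mul_distrib]
  refine Finset.prod_congr rfl fun i hi => ?_
  have hib : i ≠ b := Finset.ne_of_mem_erase hi
  by_cases h : i < b
  · rw [← Finset.mul_prod_erase (Finset.Ioi i) _ (Finset.mem_Ioi.2 h), if_neg h.not_gt, if_neg h.not_gt]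
    ring
  · have h' : b < i := lt_of_le_of_ne (not_lt.1 h) hib.symm
    rw [Finset.erase_eq_of_notMem (by simpa using h'.le), if_pos h', if_pos h']
    ring

lemma vand_update {k : ℕ} (v : Fin k → ℂ) (b : Fin k) (y : ℂ) :
    (Matrix.vandermonde (Function.update v b y)).det * ∏ i ∈ Finset.univ.erase b, (v b - v i) =
    (Matrix.vandermonde v).det * ∏ i ∈ Finset.univ.erase b, (y - v i) := by
  rw [vand_split v b, vand_split _ b]
  have h1 : (∏ i ∈ Finset.univ.erase b, ∏ j ∈ (Finset.Ioi i).erase b, (Function.update v b y j - Function.update v b y i))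
     = (∏ i ∈ Finset.univ.erase b, ∏ j ∈ (Finset.Ioi i).erase b, (v j - v i)) := by
    refine Finset.prod_congr rfl fun i hi => Finset.prod_congr rfl fun j hj => ?_
    rw [Function.update_of_ne (Finset.ne_of_mem_erase hi), Function.update_of_ne (Finset.ne_of_mem_erase hj)]
  have h2 : ∏ i ∈ Finset.univ.erase b, (Function.update v b y b - Function.update v b y i) = 
      ∏ i ∈ Finset.univ.erase b, (y - v i) := by
    refine Finset.prod_congr rfl fun i hi => ?_
    rw [Function.update_of_ne (Finset.ne_of_mem_erase hi), Function.update_self]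
  rw [h1, h2]
  ring

/-- the sum over beads -/
noncomputable def SS (k m : ℕ) : ℂ := ∑ b : Fin k, ((2 * (b : ℕ) + 1).descFactorial m : ℂ) *
  ∏ j ∈ Finset.univ.erase b, ((2 * ((b : ℕ) : ℂ) - 2 * ((j : ℕ) : ℂ) - m) / (2 * ((b : ℕ) : ℂ) - 2 * ((j : ℕ) : ℂ)))

lemma lst_apply (k : ℕ) (i : Fin k) : lst k i = 2 * (i : ℕ) + 1 := rfl

lemma sum_fin_val (k n : ℕ) (hn : n = k * (k + 1) / 2) : ∑ i : Fin k, (2 * (i : ℕ) + 1) = n + ∑ i : Fin k, (i : ℕ) := by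
  rw [Fin.sum_univ_eq_sum_range (fun i => 2 * i + 1), Fin.sum_univ_eq_sum_range (fun i => i), Finset.sum_range_id]
  have h1 : ∑ i ∈ Finset.range k, (2 * i + 1) = k * k := by
    clear hn
    induction k with
    | zero => rfl
    | succ k ih => rw [Finset.sum_range_succ, ih]; ring
  rw [h1, hn]
  cases k with
  | zero => rfl
  | succ k =>
    have h2 : 2 ∣ (k + 1) * (k + 1 + 1) := (Nat.even_mul_succ_self (k+1)).two_dvd
    have h3 : 2 ∣ (k + 1) * (k + 1 - 1) := by
      rw [mul_comm]; exact (Nat.even_mul_succ_self k).two_dvd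
    obtain ⟨u, hu⟩ := h2
    obtain ⟨v, hv⟩ := h3
    rw [hu, hv]
    simp at hv
    have : (k+1)*(k+1) * 2 = 2 * u + 2 * v := by rw [← hu, ← hv]; ring
    omega

open MvPolynomial Equiv in
lemma FF_one (k n : ℕ) (hn : n = k * (k + 1) / 2) :
    FF k (1 : Perm (Fin n)) * ∏ i, ((lst k i).factorial : ℂ) =
      (n.factorial : ℂ) * (Matrix.vandermonde fun i => (lst k i : ℂ)).det := by
  unfold FF
  rw [pg_one, Fintype.card_fin]
  exact coeff_vd_pow _ _ (sum_fin_val k n hn)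

lemma vand_lst_ne (k : ℕ) : (Matrix.vandermonde fun i => (lst k i : ℂ)).det ≠ 0 := by
  rw [Matrix.det_vandermonde_ne_zero_iff]
  intro i j h
  simp only [lst_apply, Nat.cast_inj] at h
  ext; omega

lemma prod_fact_ne {k : ℕ} (e : Fin k →₀ ℕ) : ∏ i, ((e i).factorial : ℂ) ≠ 0 := by
  apply Finset.prod_ne_zero_iff.2
  intro i _
  exact_mod_cast Nat.factorial_ne_zero _

lemma FF_one_ne (k n : ℕ) (hn : n = k * (k + 1) / 2) : FF k (1 : Equiv.Perm (Fin n)) ≠ 0 := by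
  intro h
  have h1 := FF_one k n hn
  rw [h, zero_mul] at h1
  have h2 : (n.factorial : ℂ) ≠ 0 := by exact_mod_cast Nat.factorial_ne_zero _
  exact mul_ne_zero h2 (vand_lst_ne k) h1.symm

open MvPolynomial Equiv in
lemma pg_single_cycle {n : ℕ} (k m : ℕ) (g : Perm (Fin n)) (hg : g.cycleType = {m}) :
    pg k g = (∑ b, X b ^ m) * (∑ b, X b) ^ (n - m) := by
  have hcard : g.support.card = m := by
    rw [← Perm.sum_cycleType, hg]; simp
  have hcyc : g.IsCycle := by
    rw [← Perm.card_cycleType_eq_one, hg]; rfl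
  have hmem : g ∈ g.cycleFactorsFinset := by
    rw [hcyc.cycleFactorsFinset_eq_singleton]; simp
  rw [pg_cycle k g g hmem (cycle_inv g g hmem), hcard]
  congr 1
  have : g.subtypePerm (p := fun x => ¬ (x ∈ g.support)) (cycle_inv g g hmem) = 1 := by
    ext ⟨x, hx⟩
    simp only [Perm.subtypePerm_apply, Perm.coe_one, id]
    rw [Perm.notMem_support.1 hx]
  rw [this, pg_one]
  congr 1
  rw [Fintype.card_subtype_compl, Fintype.card_fin]
  congr 1
  rw [← hcard, ← Fintype.card_coe g.support]

open MvPolynomial Equiv in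
lemma FF_cycle (k n m : ℕ) (hn : n = k * (k + 1) / 2) (hm : m ≤ n) (g : Perm (Fin n)) (hg : g.cycleType = {m}) :
    FF k g * (n.descFactorial m : ℂ) = FF k (1 : Perm (Fin n)) * SS k m := by
  have hP := prod_fact_ne (lst k)
  apply mul_right_cancel₀ hP
  have h1 := FF_one k n hn
  have h2 : FF k g * ∏ i, ((lst k i).factorial : ℂ) = ((n - m).factorial : ℂ) * ((Matrix.vandermonde fun i => (lst k i : ℂ)).det * SS k m) := by
    have h3 : FF k g = ∑ b, if m ≤ lst k b then coeff (lst k - Finsupp.single b m) (vd k * (∑ b, X b) ^ (n - m)) else 0 := by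
      unfold FF
      rw [pg_single_cycle k m g hg, mul_comm (∑ b, X b ^ m), ← mul_assoc, coeff_mul_psum]
    rw [h3]
    unfold SS
    rw [Finset.sum_mul, Finset.mul_sum, Finset.mul_sum]
    refine Finset.sum_congr rfl fun b _ => ?_
    split_ifs with hb
    · have hle : Finsupp.single b m ≤ lst k := by rwa [Finsupp.single_le_iff]
      have hsum : ∑ i, (lst k - Finsupp.single b m) i = (n - m) + ∑ i : Fin k, (i : ℕ) := by
        have h4 : ∑ i, (lst k - Finsupp.single b m) i + ∑ i, Finsupp.single b m i = ∑ i, lst k i := by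
          rw [← Finset.sum_add_distrib]
          refine Finset.sum_congr rfl fun i _ => ?_
          rw [Finsupp.tsub_apply]
          exact Nat.sub_add_cancel (hle i)
        have h5 : ∑ i, Finsupp.single b m i = m := by simp [Finsupp.single_apply]
        have h6 : ∑ i, lst k i = n + ∑ i : Fin k, (i : ℕ) := sum_fin_val k n hn
        omega
      have h7 := coeff_vd_pow _ _ hsum
      have h8 : ∏ i, ((lst k i).factorial : ℂ) = (∏ i, (((lst k - Finsupp.single b m) i).factorial : ℂ)) * ((2 * (b : ℕ) + 1).descFactorial m : ℂ) := by
        rw [← Finset.mul_prod_erase _ _ (Finset.mem_univ b), ← Finset.mul_prod_erase _ (fun i => (((lst k - Finsupp.single b m) i).factorial : ℂ)) (Finset.mem_univ b)]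
        have h9 : ∏ i ∈ Finset.univ.erase b, (((lst k - Finsupp.single b m) i).factorial : ℂ) = ∏ i ∈ Finset.univ.erase b, ((lst k i).factorial : ℂ) := by
          refine Finset.prod_congr rfl fun i hi => ?_
          rw [Finsupp.tsub_apply, Finsupp.single_eq_of_ne (Finset.ne_of_mem_erase hi), Nat.sub_zero]
        rw [h9, Finsupp.tsub_apply, Finsupp.single_eq_same, ← Nat.factorial_mul_descFactorial hb]
        push_cast
        rw [lst_apply]
        ring
      rw [h8, ← mul_assoc, h7]
      have h10 : (fun i => (((lst k - Finsupp.single b m) i : ℕ) : ℂ)) = Function.update (fun i => (lst k i : ℂ)) b ((lst k b : ℂ) - m) := by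
        funext i
        by_cases hi : i = b
        · subst hi
          rw [Function.update_self, Finsupp.tsub_apply, Finsupp.single_eq_same, Nat.cast_sub hb]
        · rw [Function.update_of_ne hi, Finsupp.tsub_apply, Finsupp.single_eq_of_ne hi, Nat.sub_zero]
      have h11 := vand_update (fun i => (lst k i : ℂ)) b ((lst k b : ℂ) - m)
      rw [← h10] at h11
      have hne : ∏ i ∈ Finset.univ.erase b, ((lst k b : ℂ) - lst k i) ≠ 0 := by
        apply Finset.prod_ne_zero_iff.2
        intro i hi
        rw [sub_ne_zero]
        simp only [lst_apply, ne_eq, Nat.cast_inj]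
        intro h
        exact Finset.ne_of_mem_erase hi (by ext; omega)
      have h12 : ∏ j ∈ Finset.univ.erase b, ((2 * ((b : ℕ) : ℂ) - 2 * ((j : ℕ) : ℂ) - m) / (2 * ((b : ℕ) : ℂ) - 2 * ((j : ℕ) : ℂ)))
         = (∏ i ∈ Finset.univ.erase b, ((lst k b : ℂ) - m - lst k i)) / ∏ i ∈ Finset.univ.erase b, ((lst k b : ℂ) - lst k i) := by
        rw [← Finset.prod_div_distrib]
        refine Finset.prod_congr rfl fun i hi => ?_
        simp only [lst_apply]
        push_cast
        congr 1 <;> ring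
      rw [h12]
      rw [← eq_div_iff hne] at h11
      rw [h11]
      ring
    · rw [lst_apply] at hb
      rw [Nat.descFactorial_eq_zero_iff_lt.2 (by omega)]
      simp
  have h13 : (n.factorial : ℂ) = ((n - m).factorial : ℂ) * (n.descFactorial m : ℂ) := by
    rw [← Nat.cast_mul, Nat.factorial_mul_descFactorial hm]
  rw [h13] at h1
  linear_combination (n.descFactorial m : ℂ) * h2 - SS k m * h1


/-- rising binomials -/
noncomputable def AA (x : ℂ) (c : ℕ) : ℂ := ∏ d ∈ Finset.range c, (x + d) / (d + 1)

lemma AA_succ (x : ℂ) (c : ℕ) : ((c : ℂ) + 1) * AA x (c + 1) = (x + c) * AA x c := by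
  unfold AA
  rw [Finset.prod_range_succ]
  have : ((c : ℂ) + 1) ≠ 0 := Nat.cast_add_one_ne_zero c
  field_simp

lemma AA_vander (x y : ℂ) (M : ℕ) :
    ∑ p ∈ Finset.HasAntidiagonal.antidiagonal M, AA x p.1 * AA y p.2 = AA (x + y) M := by
  induction M with
  | zero => simp [AA]
  | succ M ih =>
    have h0 : ((M : ℂ) + 1) ≠ 0 := Nat.cast_add_one_ne_zero M
    apply mul_left_cancel₀ h0
    rw [AA_succ, ← ih]
    have h1 : ((M : ℂ) + 1) * ∑ p ∈ Finset.HasAntidiagonal.antidiagonal (M + 1), AA x p.1 * AA y p.2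
       = ∑ p ∈ Finset.HasAntidiagonal.antidiagonal (M + 1), ((p.1 : ℂ) * AA x p.1 * AA y p.2)
       + ∑ p ∈ Finset.HasAntidiagonal.antidiagonal (M + 1), (AA x p.1 * ((p.2 : ℂ) * AA y p.2)) := by
      rw [Finset.mul_sum, ← Finset.sum_add_distrib]
      refine Finset.sum_congr rfl fun p hp => ?_
      rw [Finset.HasAntidiagonal.mem_antidiagonal] at hp
      have : (p.1 : ℂ) + p.2 = M + 1 := by exact_mod_cast hp
      rw [← this]; ring
    rw [h1, Finset.Nat.sum_antidiagonal_succ, Finset.Nat.sum_antidiagonal_succ']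
    simp only [Nat.cast_zero, zero_mul, mul_zero, zero_add, Nat.cast_add, Nat.cast_one, AA_succ, add_zero]
    rw [Finset.mul_sum, ← Finset.sum_add_distrib]
    refine Finset.sum_congr rfl fun p hp => ?_
    rw [Finset.HasAntidiagonal.mem_antidiagonal] at hp
    have : (p.1 : ℂ) + p.2 = M := by exact_mod_cast hp
    rw [← this]; ring

lemma dF_AA (r c : ℕ) : ((2 * (r + c) + 1).descFactorial (2 * r + 1) : ℂ) * AA (1 / 2 - r) (r + c) =
    ((2 * r + 1).factorial : ℂ) * AA (1 / 2 - r) r * AA (r + 3 / 2) c := by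
  induction c with
  | zero => rw [add_zero, Nat.descFactorial_self]; simp [AA]
  | succ c ih =>
    have e1 := Nat.factorial_mul_descFactorial (show 2 * r + 1 ≤ 2 * (r + c) + 1 by omega)
    have e2 := Nat.factorial_mul_descFactorial (show 2 * r + 1 ≤ 2 * (r + (c + 1)) + 1 by omega)
    rw [show 2 * (r + c) + 1 - (2 * r + 1) = 2 * c by omega] at e1
    rw [show 2 * (r + (c + 1)) + 1 - (2 * r + 1) = 2 * c + 1 + 1 by omega,
      Nat.factorial_succ, Nat.factorial_succ, show 2 * (r + (c + 1)) + 1 = (2 * (r + c) + 1 + 1) + 1 by ring,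
      Nat.factorial_succ (2 * (r + c) + 1 + 1), Nat.factorial_succ (2 * (r + c) + 1), ← e1] at e2
    rw [show 2 * (r + (c + 1)) + 1 = (2 * (r + c) + 1 + 1) + 1 by ring]
    have a1 := AA_succ (1 / 2 - r) (r + c)
    have a2 := AA_succ (r + 3 / 2) c
    rw [show r + (c + 1) = r + c + 1 by ring]
    generalize AA (1 / 2 - r) (r + c + 1) = P' at *
    generalize AA (1 / 2 - r) (r + c) = P at *
    generalize AA (r + 3 / 2) (c + 1) = Q' at *
    generalize AA (r + 3 / 2) c = Q at *
    generalize AA (1 / 2 - r) r = K at *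
    generalize Nat.descFactorial (2 * (r + c) + 1) (2 * r + 1) = D at *
    generalize Nat.descFactorial (2 * (r + c) + 1 + 1 + 1) (2 * r + 1) = D' at *
    have f0 : ((2 * c).factorial : ℂ) ≠ 0 := by exact_mod_cast Nat.factorial_ne_zero _
    have e3 : (2 * (c : ℂ) + 1 + 1) * (2 * c + 1) * D' = (2 * (r + c) + 1 + 1 + 1) * (2 * (r + c) + 1 + 1) * D := by
      apply mul_left_cancel₀ f0
      have : (((2 * c + 1 + 1) * ((2 * c + 1) * (2 * c).factorial) * D' : ℕ) : ℂ) = _ := congrArg _ e2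
      push_cast at this
      linear_combination this
    have c1 : (2 * (c : ℂ) + 1) ≠ 0 := by exact_mod_cast (show 2 * c + 1 ≠ 0 by omega)
    have c2 : ((c : ℂ) + 1) ≠ 0 := by exact_mod_cast (show c + 1 ≠ 0 by omega)
    have c3 : ((r : ℂ) + c + 1) ≠ 0 := by exact_mod_cast (show r + c + 1 ≠ 0 by omega)
    push_cast at a1
    have a1' : P' = (1 / 2 - r + (r + c)) * P / (r + c + 1) := by
      rw [eq_div_iff c3]; linear_combination a1
    have a2' : Q' = (r + 3 / 2 + c) * Q / (c + 1) := by
      rw [eq_div_iff c2]; linear_combination a2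
    have e3' : (D' : ℂ) = (2 * (r + c) + 1 + 1 + 1) * (2 * (r + c) + 1 + 1) * D / ((2 * (c : ℂ) + 1 + 1) * (2 * c + 1)) := by
      rw [eq_div_iff]
      · linear_combination e3
      · apply mul_ne_zero _ c1
        intro h; apply c2; linear_combination h / 2
    rw [a1', a2', e3']
    have c4 : (2 * (c : ℂ) + 1 + 1) ≠ 0 := by
      intro h; apply c2; linear_combination h / 2
    field_simp
    linear_combination (2 * (r + c) + 1 + 1 + 1) * (2 * ((c:ℂ)+1)) * (2 * c + 1) * ((r:ℂ) + c + 1) * ih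

lemma prod_AA (k r : ℕ) (b : Fin k) :
    ∏ j ∈ Finset.univ.erase b, ((2 * ((b : ℕ) : ℂ) - 2 * ((j : ℕ) : ℂ) - (2 * r + 1 : ℕ)) / (2 * ((b : ℕ) : ℂ) - 2 * ((j : ℕ) : ℂ))) =
      AA (1 / 2 - r) b * AA (r + 3 / 2) (k - 1 - b) := by
  set f : ℕ → ℂ := fun j => (2 * ((b : ℕ) : ℂ) - 2 * (j : ℂ) - (2 * r + 1 : ℕ)) / (2 * ((b : ℕ) : ℂ) - 2 * (j : ℂ)) with hf
  have h1 : ∏ j ∈ Finset.univ.erase b, f j = ∏ j ∈ (Finset.range k).erase b, f j := by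
    refine Finset.prod_bij (fun j _ => (j : ℕ)) ?_ ?_ ?_ ?_
    · intro j hj
      rw [Finset.mem_erase] at hj ⊢
      exact ⟨fun h => hj.1 (Fin.ext h), Finset.mem_range.2 j.2⟩
    · intro i _ j _ h; exact Fin.ext h
    · intro j hj
      rw [Finset.mem_erase, Finset.mem_range] at hj
      exact ⟨⟨j, hj.2⟩, by rw [Finset.mem_erase]; exact ⟨fun h => hj.1 (congrArg Fin.val h), Finset.mem_univ _⟩, rfl⟩
    · intro j _; rfl
  have h2 : (Finset.range k).erase b = Finset.range b ∪ Finset.Ico (b + 1) k := by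
    ext j
    have := b.2
    simp only [Finset.mem_erase, Finset.mem_range, Finset.mem_union, Finset.mem_Ico]
    omega
  have h3 : Disjoint (Finset.range b) (Finset.Ico ((b : ℕ) + 1) k) := by
    rw [Finset.disjoint_left]
    intro j
    simp only [Finset.mem_range, Finset.mem_Ico]
    omega
  change ∏ j ∈ Finset.univ.erase b, f j = _
  rw [h1, h2, Finset.prod_union h3]
  congr 1
  · unfold AA
    rw [← Finset.prod_range_reflect]
    refine Finset.prod_congr rfl fun d hd => ?_
    rw [Finset.mem_range] at hd
    simp only [hf]
    have hc : ((((b : ℕ) - 1 - d : ℕ) : ℂ)) = b - 1 - d := by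
      rw [Nat.sub_sub, Nat.cast_sub (by omega)]; push_cast; ring
    rw [hc]
    have : ((d : ℂ) + 1) ≠ 0 := Nat.cast_add_one_ne_zero d
    rw [div_eq_div_iff _ this]
    · push_cast; ring
    · intro h; apply this; linear_combination h / 2
  · unfold AA
    rw [Finset.prod_Ico_eq_prod_range, show k - ((b : ℕ) + 1) = k - 1 - b by omega]
    refine Finset.prod_congr rfl fun d hd => ?_
    simp only [hf]
    have : ((d : ℂ) + 1) ≠ 0 := Nat.cast_add_one_ne_zero d
    rw [div_eq_div_iff _ this]
    · push_cast; ring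
    · intro h; apply this; push_cast at h; linear_combination - h / 2

lemma SS_small (k r : ℕ) (h : k ≤ r) : SS k (2 * r + 1) = 0 := by
  unfold SS
  apply Finset.sum_eq_zero
  intro b _
  rw [Nat.descFactorial_eq_zero_iff_lt.2 (by omega)]
  simp

lemma SS_eq (r M : ℕ) : SS (r + 1 + M) (2 * r + 1) =
    ((2 * r + 1).factorial : ℂ) * AA (1 / 2 - r) r * AA (2 * r + 3) M := by
  have h1 : SS (r + 1 + M) (2 * r + 1) = ∑ b ∈ Finset.range (r + 1 + M), 
      ((2 * b + 1).descFactorial (2 * r + 1) : ℂ) * (AA (1 / 2 - r) b * AA (r + 3 / 2) (r + 1 + M - 1 - b)) := by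
    unfold SS
    rw [← Fin.sum_univ_eq_sum_range (fun b => ((2 * b + 1).descFactorial (2 * r + 1) : ℂ) * (AA (1 / 2 - r) b * AA (r + 3 / 2) (r + 1 + M - 1 - b)))]
    exact Finset.sum_congr rfl fun b _ => by rw [prod_AA]
  rw [h1, show r + 1 + M = r + (M + 1) by ring, Finset.sum_range_add]
  have h2 : ∑ b ∈ Finset.range r, 
      ((2 * b + 1).descFactorial (2 * r + 1) : ℂ) * (AA (1 / 2 - r) b * AA (r + 3 / 2) (r + (M + 1) - 1 - b)) = 0 := by
    apply Finset.sum_eq_zero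
    intro b hb
    rw [Finset.mem_range] at hb
    rw [Nat.descFactorial_eq_zero_iff_lt.2 (by omega)]
    simp
  rw [h2, zero_add]
  have h3 := AA_vander (r + 3 / 2) (r + 3 / 2) M
  rw [Finset.Nat.sum_antidiagonal_eq_sum_range_succ_mk] at h3
  rw [show (2 * r + 3 : ℂ) = (r + 3 / 2) + (r + 3 / 2) by ring, ← h3, Finset.mul_sum]
  refine Finset.sum_congr rfl fun c _ => ?_
  rw [← mul_assoc, dF_AA, show r + (M + 1) - 1 - (r + c) = M - c by omega]
  ring

lemma PP_eq (r M : ℕ) : (∏ i ∈ Finset.range (r + 1), (((r + 1 + M : ℕ) : ℂ) - i) * (((r + 1 + M : ℕ) : ℂ) + 1 + i)) * (M.factorial : ℂ)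
    = ((2 * r + 2 + M).factorial : ℂ) := by
  induction r generalizing M with
  | zero =>
    simp only [zero_add, Finset.prod_range_one]
    rw [show 2 * 0 + 2 + M = (M + 1) + 1 by ring, Nat.factorial_succ, Nat.factorial_succ]
    push_cast; ring
  | succ r ih =>
    have := ih (M + 1)
    rw [Finset.prod_range_succ, show r + 1 + 1 + M = r + 1 + (M + 1) by ring, 
      show 2 * (r + 1) + 2 + M = (2 * r + 2 + (M + 1)) + 1 by ring, Nat.factorial_succ, Nat.cast_mul, ← this, Nat.factorial_succ M]
    push_cast
    ring

lemma AA_fact (N M : ℕ) : AA (N + 1) M * ((N.factorial : ℂ) * (M.factorial : ℂ)) = ((N + M).factorial : ℂ) := by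
  induction M with
  | zero => simp [AA]
  | succ M ih =>
    have := AA_succ (N + 1) M
    rw [← add_assoc, Nat.factorial_succ, Nat.factorial_succ (N + M)]
    push_cast
    linear_combination (N.factorial : ℂ) * (M.factorial : ℂ) * this + (N + M + 1) * ih

lemma AA_half (r : ℕ) : AA (1 / 2 - r) r * (4 ^ r * (r.factorial : ℂ) ^ 2) = (-1) ^ r * ((2 * r).factorial : ℂ) := by
  unfold AA
  rw [Finset.prod_div_distrib, ← Finset.prod_range_reflect]
  have h1 : ∏ j ∈ Finset.range r, (1 / 2 - (r : ℂ) + ((r - 1 - j : ℕ) : ℂ)) = ∏ j ∈ Finset.range r, (- 1 / 2 - (j : ℂ)) := by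
    refine Finset.prod_congr rfl fun j hj => ?_
    rw [Finset.mem_range] at hj
    rw [Nat.sub_sub, Nat.cast_sub (by omega)]; push_cast; ring
  have h2 : ∏ d ∈ Finset.range r, ((d : ℂ) + 1) = r.factorial := by
    rw [← Finset.prod_range_add_one_eq_factorial]; push_cast; rfl
  have h3 : (r.factorial : ℂ) ≠ 0 := by exact_mod_cast Nat.factorial_ne_zero _
  rw [h1, h2, div_mul_eq_mul_div, div_eq_iff h3]
  have h4 : (∏ j ∈ Finset.range r, (- 1 / 2 - (j : ℂ))) * 4 ^ r * r.factorial = (-1) ^ r * ((2 * r).factorial : ℂ) := by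
    clear h1 h2 h3
    induction r with
    | zero => simp
    | succ r ih =>
      rw [Finset.prod_range_succ, show 2 * (r + 1) = 2 * r + 1 + 1 by ring, Nat.factorial_succ r, Nat.factorial_succ (2 * r + 1),
        Nat.factorial_succ (2 * r)]
      push_cast
      linear_combination (- 1 / 2 - (r : ℂ)) * 4 * (r + 1) * ih
  linear_combination (r.factorial : ℂ) * h4

lemma cat_fact (r : ℕ) : (catalan r : ℂ) * ((r : ℂ) + 1) * (r.factorial : ℂ) ^ 2 = ((2 * r).factorial : ℂ) := by
  have h1 := succ_mul_catalan_eq_centralBinom r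
  have h2 := Nat.choose_mul_factorial_mul_factorial (show r ≤ 2 * r by omega)
  rw [← Nat.centralBinom_eq_two_mul_choose, ← h1, show 2 * r - r = r by omega] at h2
  rw [← h2]
  push_cast
  ring

lemma SS_val (k n r : ℕ) (hn : n = k * (k + 1) / 2) :
    (-2 : ℂ) ^ r * SS k (2 * r + 1) = (catalan r : ℂ) * n * 
      ∏ i ∈ Finset.Icc 1 r, ((n : ℂ) - (i : ℂ) * ((i : ℂ) + 1) / 2) := by
  have hn2 : (n : ℂ) = k * (k + 1) / 2 := by
    obtain ⟨u, hu⟩ := (Nat.even_mul_succ_self k).two_dvd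
    have : n = u := by omega
    rw [this]
    have : ((k * (k + 1) : ℕ) : ℂ) = ((2 * u : ℕ) : ℂ) := by rw [hu]
    push_cast at this
    rw [this]; ring
  have h1 : (n : ℂ) * ∏ i ∈ Finset.Icc 1 r, ((n : ℂ) - (i : ℂ) * ((i : ℂ) + 1) / 2) = 
      (∏ i ∈ Finset.range (r + 1), ((k : ℂ) - i) * ((k : ℂ) + 1 + i)) / 2 ^ (r + 1) := by
    rw [← Finset.card_range (r + 1), ← Finset.prod_const, Finset.card_range, ← Finset.prod_div_distrib, Finset.prod_range_succ', mul_comm]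
    congr 1
    · rw [Finset.range_eq_Ico, Finset.prod_Ico_add' (fun i : ℕ => ((k : ℂ) - i) * ((k : ℂ) + 1 + i) / 2) 0 r 1]
      refine Finset.prod_congr rfl fun i _ => ?_
      rw [hn2]; ring
    · rw [hn2]; push_cast; ring
  rw [mul_assoc, h1]
  by_cases hk : k ≤ r
  · rw [SS_small k r hk]
    rw [Finset.prod_eq_zero (Finset.mem_range.2 (Nat.lt_succ_of_le hk))]
    · simp
    · simp
  · obtain ⟨M, rfl⟩ := Nat.exists_eq_add_of_le (show r + 1 ≤ k by omega)
    rw [SS_eq]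
    have p1 := PP_eq r M
    have p2 := AA_fact (2 * r + 2) M
    have p3 := AA_half r
    have p4 := cat_fact r
    push_cast at p2
    rw [show (2 * (r : ℂ) + 2 + 1) = 2 * r + 3 by ring] at p2
    have hM : (M.factorial : ℂ) ≠ 0 := by exact_mod_cast Nat.factorial_ne_zero _
    have hr : (r.factorial : ℂ) ≠ 0 := by exact_mod_cast Nat.factorial_ne_zero _
    have hr1 : ((r : ℂ) + 1) ≠ 0 := Nat.cast_add_one_ne_zero r
    have hf : ((2 * r + 1).factorial : ℂ) ≠ 0 := by exact_mod_cast Nat.factorial_ne_zero _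
    have p5 : ((2 * r + 2).factorial : ℂ) = 2 * (r + 1) * ((2 * r + 1).factorial : ℂ) := by
      rw [show 2 * r + 2 = 2 * r + 1 + 1 by ring, Nat.factorial_succ]; push_cast; ring
    rw [p5] at p2
    rw [← p1] at p2
    rw [← p4] at p3
    generalize (∏ i ∈ Finset.range (r + 1), (((r + 1 + M : ℕ) : ℂ) - i) * (((r + 1 + M : ℕ) : ℂ) + 1 + i)) = PP at *
    have q2 : ((2 * r + 1).factorial : ℂ) * AA (2 * r + 3) M = PP / (2 * (r + 1)) := by
      rw [eq_div_iff (mul_ne_zero two_ne_zero hr1)]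
      apply mul_right_cancel₀ hM
      linear_combination p2
    have q3 : AA (1 / 2 - r) r = (-1) ^ r * ((catalan r : ℂ) * (r + 1)) / 4 ^ r := by
      rw [eq_div_iff (pow_ne_zero _ (by norm_num : (4 : ℂ) ≠ 0))]
      apply mul_right_cancel₀ (pow_ne_zero 2 hr)
      linear_combination p3
    have q4 : (-2 : ℂ) ^ r * (((2 * r + 1).factorial : ℂ) * AA (1 / 2 - r) r * AA (2 * r + 3) M) = 
       (-2) ^ r * AA (1 / 2 - r) r * (((2 * r + 1).factorial : ℂ) * AA (2 * r + 3) M) := by ring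
    rw [q4, q2, q3, show (-2 : ℂ) = (-1) * 2 by ring, show (4 : ℂ) = 2 * 2 by ring, mul_pow, mul_pow]
    have q5 : ((-1 : ℂ)) ^ r * (-1) ^ r = 1 := by rw [← mul_pow]; simp
    field_simp
    linear_combination (catalan r : ℂ) * PP * 2 ^ r * 2 * q5


open Equiv in
lemma char_swap_sum {n : ℕ} (V : FDRep ℂ (Perm (Fin n))) [CategoryTheory.Simple V] :
    ∃ c : ℂ, ∀ g, ∑ i, ∑ j, (if i ≠ j then V.character (swap i j * g) else 0) = c * V.character g := by
  obtain ⟨c, hc⟩ := char_sum_scalar V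
    (fun x => ∑ i : Fin n, ∑ j : Fin n, if i ≠ j ∧ swap i j = x then (1 : ℂ) else 0) (by
      intro g h
      rw [← Equiv.sum_comp g]
      refine Finset.sum_congr rfl fun i _ => ?_
      rw [← Equiv.sum_comp g]
      refine Finset.sum_congr rfl fun j _ => ?_
      congr 1
      apply propext
      rw [Equiv.swap_apply_apply]
      simp)
  refine ⟨c, fun g => ?_⟩
  rw [← hc g]
  simp only [Finset.sum_mul]
  symm
  rw [Finset.sum_comm]
  refine Finset.sum_congr rfl fun i _ => ?_
  rw [Finset.sum_comm]
  refine Finset.sum_congr rfl fun j _ => ?_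
  by_cases h : i = j
  · simp [h]
  · simp [h]

lemma FF_conj (k : ℕ) {n : ℕ} (g h : Equiv.Perm (Fin n)) : FF k (g * h * g⁻¹) = FF k h := by
  unfold FF
  rw [pg_conj]

open Equiv in
lemma FF_swap_sum (k : ℕ) {n : ℕ} (h : Perm (Fin n)) (hh : 2 ∣ orderOf h) :
    ∑ i, ∑ j, (if i ≠ j then FF k (swap i j * h) else 0) = 0 := by
  obtain ⟨c, hc⟩ := FF_T k n
  have h1 := hc h
  rw [FF_even k h hh, mul_zero] at h1
  refine Eq.trans ?_ h1
  refine Finset.sum_congr rfl fun i _ => Finset.sum_congr rfl fun j _ => ?_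
  split_ifs with hij
  · rfl
  · push Not at hij
    subst hij
    rw [swap_self]
    exact (FF_even k h hh).symm

theorem stmt9 (k n r : ℕ) (hk : 1 ≤ k) (hr : 1 ≤ r) (hn : n = k * (k + 1) / 2)
    (h2r : 2 * r + 1 ≤ n)
    (V : FDRep ℂ (Equiv.Perm (Fin n))) [CategoryTheory.Simple V]
    (hdef : (Nat.factorial n).factorization 2 = (Module.finrank ℂ V).factorization 2)
    (g : Equiv.Perm (Fin n)) (hg : g.cycleType = {2 * r + 1}) :
    V.character g * (-2 : ℂ) ^ r * ∏ a ∈ Finset.Icc 1 (2 * r), ((n : ℂ) - (a : ℂ)) =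
      V.character 1 * (catalan r : ℂ) *
        ∏ i ∈ Finset.Icc 1 r, ((n : ℂ) - (i : ℂ) * ((i : ℂ) + 1) / 2) := by
  have hd : Module.finrank ℂ V ≠ 0 := by
    intro h0
    rw [h0] at hdef
    have h2 : 0 < (Nat.factorial n).factorization 2 :=
      Nat.prime_two.factorization_pos_of_dvd (Nat.factorial_ne_zero n)
        (Nat.dvd_factorial (by norm_num) (by omega))
    rw [hdef] at h2
    simp at h2
  have hcl : ∀ g h : Equiv.Perm (Fin n), V.character (g * h * g⁻¹) = V.character h := fun g h => by simp
  have heven : ∀ g : Equiv.Perm (Fin n), 2 ∣ orderOf g → V.character g = 0 :=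
    defect_zero_vanish V.character hcl (char_isIntegral V) _ hd (char_conv V)
      (by rw [Fintype.card_perm, Fintype.card_fin]; exact hdef)
  obtain ⟨c, hc⟩ := char_swap_sum V
  have key := class_fun_unique
    (fun x => FF k (1 : Equiv.Perm (Fin n)) * V.character x - V.character 1 * FF k x)
    (by intro g h; rw [hcl, FF_conj])
    (by intro g hg; rw [heven g hg, FF_even k g hg]; ring)
    (by
      intro h hh
      have e1 := hc h
      have e2 := FF_swap_sum k h hh
      rw [heven h hh, mul_zero] at e1
      have : ∑ i, ∑ j, (if i ≠ j then (FF k (1 : Equiv.Perm (Fin n)) * V.character (Equiv.swap i j * h)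
          - V.character 1 * FF k (Equiv.swap i j * h)) else 0) =
          FF k (1 : Equiv.Perm (Fin n)) * (∑ i, ∑ j, (if i ≠ j then V.character (Equiv.swap i j * h) else 0))
          - V.character 1 * ∑ i, ∑ j, (if i ≠ j then FF k (Equiv.swap i j * h) else 0) := by
        simp only [Finset.mul_sum]
        rw [← Finset.sum_sub_distrib]
        refine Finset.sum_congr rfl fun i _ => ?_
        rw [← Finset.sum_sub_distrib]
        refine Finset.sum_congr rfl fun j _ => ?_
        split_ifs <;> simp
      rw [this, e1, e2]; ring)
    (by ring) g
  have hF := FF_one_ne k n hn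
  have hcyc := FF_cycle k n (2 * r + 1) hn h2r g hg
  have hval := SS_val k n r hn
  have hn0 : (n : ℂ) ≠ 0 := by
    have : n ≠ 0 := by omega
    exact_mod_cast this
  have hdesc : (n.descFactorial (2 * r + 1) : ℂ) = n * ∏ a ∈ Finset.Icc 1 (2 * r), ((n : ℂ) - (a : ℂ)) := by
    rw [Nat.descFactorial_eq_prod_range, Finset.prod_range_succ', mul_comm]
    push_cast
    congr 1
    rw [Finset.range_eq_Ico, Finset.prod_Ico_add' (fun i : ℕ => ((n - i : ℕ) : ℂ)) 0 (2 * r) 1]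
    refine Finset.prod_congr rfl fun i hi => ?_
    rw [Finset.mem_Icc] at hi
    rw [Nat.cast_sub (by omega)]
  rw [hdesc] at hcyc
  generalize ∏ a ∈ Finset.Icc 1 (2 * r), ((n : ℂ) - (a : ℂ)) = P1 at *
  generalize ∏ i ∈ Finset.Icc 1 r, ((n : ℂ) - (i : ℂ) * ((i : ℂ) + 1) / 2) = P2 at *
  apply mul_left_cancel₀ (mul_ne_zero hF hn0)
  linear_combination (-2) ^ r * n * P1 * key + V.character 1 * (-2) ^ r * hcyc + V.character 1 * FF k (1 : Equiv.Perm (Fin n)) * hval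
end

section
/- For every n and every complex irreducible character χ of S_n (n ≥ 4), the normalized value at a double transposition satisfies χ((2²))/χ(1) > −(4n−6)/((n−2)(n−3)). -/
open Equiv Equiv.Perm

lemma aux_schur {G : Type} [Group G] (V : FDRep ℂ G) [CategoryTheory.Simple V]
    (f : V →ₗ[ℂ] V) (hf : ∀ g, f ∘ₗ V.ρ g = V.ρ g ∘ₗ f) : ∃ c : ℂ, f = c • 1 := by
  let F : V ⟶ V := ⟨FGModuleCat.ofHom f, fun g => by
    ext x
    exact LinearMap.congr_fun (hf g) x⟩
  obtain ⟨c, hc⟩ := CategoryTheory.endomorphism_simple_eq_smul_id ℂ F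
  refine ⟨c, ?_⟩
  have h := congrArg (fun φ : V ⟶ V => φ.hom.hom.hom) hc
  exact h.symm

lemma aux_char {n : ℕ} (V : FDRep ℂ (Perm (Fin n))) {g h : Perm (Fin n)}
    (e : g.cycleType = h.cycleType) : V.character g = V.character h := by
  obtain ⟨c, hc⟩ := isConj_iff.1 (isConj_iff_cycleType_eq.2 e)
  rw [← hc, FDRep.char_conj]

lemma aux_idem {M : Type*} [AddCommGroup M] [Module ℂ M] [FiniteDimensional ℂ M]
    (f : M →ₗ[ℂ] M) (hf : IsIdempotentElem f) :
    ∃ k : ℕ, k ≤ Module.finrank ℂ M ∧ LinearMap.trace ℂ M f = k :=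
  ⟨_, Submodule.finrank_le _, (LinearMap.IsIdempotentElem.isProj_range f hf).trace⟩

lemma aux_inv {G : Type} [Group G] (V : FDRep ℂ G) (s : G) (hs : s * s = 1) :
    ∃ p : ℝ, V.character s = p := by
  have h2 : V.ρ s * V.ρ s = 1 := by rw [← map_mul, hs, map_one]
  obtain ⟨k, -, hk⟩ := aux_idem ((1/2 : ℂ) • (1 + V.ρ s)) (by
    unfold IsIdempotentElem
    simp only [smul_mul_smul_comm, mul_add, add_mul, mul_one, one_mul, h2]
    module)
  have h1 := FDRep.char_one V
  refine ⟨2 * k - Module.finrank ℂ V, ?_⟩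
  rw [map_smul, map_add, LinearMap.trace_one] at hk
  change _ • (_ + V.character s) = _ at hk
  push_cast
  rw [smul_eq_mul] at hk
  linear_combination 2 * hk

lemma aux_three {G : Type} [Group G] (V : FDRep ℂ G) (s : G) (hs : s * s * s = 1)
    (he : V.character (s * s) = V.character s) :
    ∃ q : ℝ, V.character s = q ∧ q ≤ Module.finrank ℂ V ∧ (q = Module.finrank ℂ V → V.ρ s = 1) := by
  have h3 : V.ρ s * (V.ρ s * V.ρ s) = 1 := by rw [← mul_assoc, ← map_mul, ← map_mul, hs, map_one]
  have hI : IsIdempotentElem ((1/3 : ℂ) • (1 + V.ρ s + V.ρ s * V.ρ s)) := by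
    unfold IsIdempotentElem
    simp only [smul_mul_smul_comm, mul_add, add_mul, mul_one, one_mul, h3, mul_assoc]
    module
  obtain ⟨k, hkd, hk⟩ := aux_idem _ hI
  have htr := hk
  rw [map_smul, map_add, map_add, LinearMap.trace_one, ← map_mul] at hk
  change _ • (_ + V.character s + V.character (s * s)) = _ at hk
  rw [he, smul_eq_mul] at hk
  have hkd' : (k : ℝ) ≤ Module.finrank ℂ V := by exact_mod_cast hkd
  refine ⟨(3 * k - Module.finrank ℂ V) / 2, ?_, by linarith, fun hq => ?_⟩
  · push_cast
    linear_combination (3/2) * hk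
  · have hkd2 : (k : ℝ) = Module.finrank ℂ V := by linarith
    have hkd3 : (k : ℂ) = Module.finrank ℂ V := by exact_mod_cast hkd2
    have h0 := LinearMap.IsIdempotentElem.eq_zero_of_trace_eq_zero hI.one_sub (by
      rw [map_sub, htr, LinearMap.trace_one, hkd3, sub_self])
    have h1 := sub_eq_zero.1 h0
    calc V.ρ s = V.ρ s * 1 := (mul_one _).symm
      _ = V.ρ s * ((1/3 : ℂ) • (1 + V.ρ s + V.ρ s * V.ρ s)) := by rw [← h1]
      _ = (1/3 : ℂ) • (1 + V.ρ s + V.ρ s * V.ρ s) := by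
        rw [mul_smul_comm]
        simp only [mul_add, mul_one, h3]
        congr 1
        abel
      _ = 1 := h1.symm

lemma aux_sum {n : ℕ} (S : Finset (Fin n)) (h : Fin n → ℂ) (k : ℂ)
    (hk : ∀ i ∉ S, h i = k) : ∑ i, h i = ∑ i ∈ S, h i + ((n : ℂ) - S.card) * k := by
  rw [← Finset.sum_add_sum_compl S h,
    Finset.sum_congr rfl (fun i hi => hk i (Finset.mem_compl.1 hi)), Finset.sum_const,
    Finset.card_compl, Fintype.card_fin, nsmul_eq_mul, Nat.cast_sub]
  simpa using S.card_le_univ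

lemma aux_count {n : ℕ} (F : Perm (Fin n) → ℂ) (a b : Fin n) (hab : a ≠ b) (χ1 χ2 χ3 χ22 : ℂ)
    (h1 : F 1 = χ1) (h2 : ∀ g, g.cycleType = {2} → F g = χ2)
    (h3 : ∀ g, g.cycleType = {3} → F g = χ3)
    (h22 : ∀ g, g.cycleType = {2, 2} → F g = χ22) :
    ∑ i, ∑ j, F (swap a b * swap i j) =
      n * χ2 + 2 * χ1 + 4 * (n - 2) * χ3 + (n - 2) * (n - 3) * χ22 := by
  have hd : ∀ i, F (swap a b * swap i i) = χ2 := fun i => by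
    rw [swap_self, show (Equiv.refl (Fin n)) = 1 from rfl, mul_one]
    exact h2 _ (isSwap_iff_cycleType.1 ⟨a, b, hab, rfl⟩)
  have t3 : ∀ x y z : Fin n, x ≠ y → x ≠ z → y ≠ z → F (swap x y * swap x z) = χ3 :=
    fun x y z p q r => h3 _ (isThreeCycle_swap_mul_swap_same p q r)
  have ha : ∑ j, F (swap a b * swap a j) = χ2 + χ1 + (n - 2) * χ3 := by
    rw [aux_sum {a, b} _ χ3, Finset.sum_pair hab, hd, swap_mul_self, h1, Finset.card_pair hab]
    · push_cast; ring
    · intro j hj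
      simp only [Finset.mem_insert, Finset.mem_singleton, not_or] at hj
      exact t3 a b j hab (Ne.symm hj.1) (Ne.symm hj.2)
  have hb : ∑ j, F (swap a b * swap b j) = χ2 + χ1 + (n - 2) * χ3 := by
    rw [aux_sum {a, b} _ χ3, Finset.sum_pair hab, hd, swap_comm b a, swap_mul_self, h1,
      Finset.card_pair hab]
    · push_cast; ring
    · intro j hj
      simp only [Finset.mem_insert, Finset.mem_singleton, not_or] at hj
      rw [swap_comm a b]
      exact t3 b a j hab.symm (Ne.symm hj.2) (Ne.symm hj.1)
  have hi : ∀ i ∉ ({a, b} : Finset (Fin n)),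
      ∑ j, F (swap a b * swap i j) = χ2 + 2 * χ3 + (n - 3) * χ22 := by
    intro i hi
    simp only [Finset.mem_insert, Finset.mem_singleton, not_or] at hi
    have hc : ({i, a, b} : Finset (Fin n)).card = 3 := Finset.card_eq_three.2
      ⟨i, a, b, hi.1, hi.2, hab, rfl⟩
    rw [aux_sum {i, a, b} _ χ22, hc, Finset.sum_insert (by simp [hi.1, hi.2]),
      Finset.sum_pair hab, hd, swap_comm i a, swap_comm i b, t3 a b i hab (Ne.symm hi.1)
      (Ne.symm hi.2), swap_comm a b, t3 b a i hab.symm (Ne.symm hi.2) (Ne.symm hi.1)]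
    · push_cast; ring
    · intro j hj
      simp only [Finset.mem_insert, Finset.mem_singleton, not_or] at hj
      apply h22
      have hdis : Perm.Disjoint (swap a b) (swap i j) := by
        rw [disjoint_iff_disjoint_support, support_swap hab, support_swap (Ne.symm hj.1)]
        simp [hi.1, hi.2, hj.2.1, hj.2.2]
      rw [hdis.cycleType_mul, isSwap_iff_cycleType.1 ⟨a, b, hab, rfl⟩,
        isSwap_iff_cycleType.1 ⟨i, j, Ne.symm hj.1, rfl⟩]
      rfl
  rw [aux_sum {a, b} _ _ hi, Finset.sum_pair hab, ha, hb, Finset.card_pair hab]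
  push_cast; ring

/-- For `n ≥ 4` and every complex irreducible character `χ` of `S_n`, the (real) normalized
value at a double transposition satisfies `χ((2²))/χ(1) > −(4n−6)/((n−2)(n−3))`. -/
theorem stmt11 (n : ℕ) (hn : 4 ≤ n) (V : FDRep ℂ (Equiv.Perm (Fin n)))
    [CategoryTheory.Simple V]
    (g : Equiv.Perm (Fin n)) (hg : g.cycleType = {2, 2}) (r : ℝ)
    (hr : V.character g / V.character 1 = (r : ℂ)) :
    r > -((4 * (n : ℝ) - 6) / (((n : ℝ) - 2) * ((n : ℝ) - 3))) := by
  have hn' : (4 : ℝ) ≤ n := by exact_mod_cast hn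
  have hneg : -((4 * (n : ℝ) - 6) / (((n : ℝ) - 2) * ((n : ℝ) - 3))) < 0 := by
    rw [neg_lt_zero]
    exact div_pos (by linarith) (mul_pos (by linarith) (by linarith))
  have hd1 := FDRep.char_one V
  rcases Nat.eq_zero_or_pos (Module.finrank ℂ V) with h0 | hpos
  · rw [hd1, h0, Nat.cast_zero, div_zero] at hr
    have : r = 0 := by exact_mod_cast hr.symm
    rw [this]; exact hneg
  set d : ℝ := ((Module.finrank ℂ V : ℕ) : ℝ) with hd
  have hdpos : 0 < d := by rw [hd]; exact_mod_cast hpos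
  have hdC : V.character 1 = (d : ℂ) := by rw [hd1, hd]; push_cast; rfl
  have hd0 : (d : ℂ) ≠ 0 := by exact_mod_cast hdpos.ne'
  rw [hdC, div_eq_iff hd0] at hr
  let a : Fin n := ⟨0, by omega⟩
  let b : Fin n := ⟨1, by omega⟩
  let c : Fin n := ⟨2, by omega⟩
  have hab : a ≠ b := by simp [a, b]
  have hac : a ≠ c := by simp [a, c]
  have hbc : b ≠ c := by simp [b, c]
  have htc := isThreeCycle_swap_mul_swap_same hab hac hbc
  set t := swap a b * swap a c
  obtain ⟨p, hp⟩ := aux_inv V (swap a b) (swap_mul_self a b)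
  obtain ⟨q, hq, hqd, hqe⟩ := aux_three V t
    (by have h := pow_orderOf_eq_one t; rw [htc.orderOf, pow_succ, pow_two] at h; exact h)
    (aux_char V (by rw [htc.isThreeCycle_sq.cycleType, htc.cycleType]))
  have hs2 : ∀ i j : Fin n, i ≠ j → (swap i j).cycleType = {2} := fun i j h =>
    isSwap_iff_cycleType.1 ⟨i, j, h, rfl⟩
  rcases hqd.lt_or_eq with hlt | heq
  · obtain ⟨z, hz⟩ := aux_schur V (∑ i, ∑ j, V.ρ (swap i j)) (by
      intro x
      change _ * V.ρ x = V.ρ x * _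
      simp only [Finset.sum_mul, Finset.mul_sum, ← map_mul]
      rw [← Equiv.sum_comp x]
      refine Finset.sum_congr rfl fun i _ => ?_
      rw [← Equiv.sum_comp x]
      refine Finset.sum_congr rfl fun j _ => ?_
      rw [mul_swap_eq_swap_mul])
    have e1 : z * d = n * d + n * (n - 1) * p := by
      have := congrArg (LinearMap.trace ℂ V) hz
      rw [map_smul, LinearMap.trace_one, smul_eq_mul] at this
      simp only [map_sum] at this
      change ∑ i, ∑ j, V.character (swap i j) = _ at this
      rw [hd]; push_cast; rw [← this]
      have hi : ∀ i, ∑ j, V.character (swap i j) = d + (n - 1) * p := fun i => by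
        rw [aux_sum {i} _ p]
        · rw [Finset.sum_singleton, swap_self, show (Equiv.refl (Fin n)) = 1 from rfl, hdC]
          simp
        · intro j hj
          rw [← hp]
          exact aux_char V (by rw [hs2 _ _ hab, hs2]; simpa [eq_comm] using hj)
      simp only [hi, Finset.sum_const, Finset.card_univ, Fintype.card_fin, nsmul_eq_mul]
      rw [hd]; push_cast; ring
    have e2 : z * p = n * p + 2 * d + 4 * (n - 2) * q + (n - 2) * (n - 3) * (r * d) := by
      have := congrArg (fun f => LinearMap.trace ℂ V (V.ρ (swap a b) * f)) hz
      simp only [Finset.mul_sum, map_sum, ← map_mul, mul_smul_comm, mul_one, map_smul,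
        smul_eq_mul] at this
      change ∑ i, ∑ j, V.character (swap a b * swap i j) = z * V.character (swap a b) at this
      rw [← hp, ← this, hp]
      apply aux_count _ a b hab _ _ _ _ hdC
      · intro g h; rw [← hp]; exact aux_char V (by rw [hs2 _ _ hab, h])
      · intro g h; rw [← hq]; exact aux_char V (by rw [htc.cycleType, h])
      · intro g' h; rw [← hr]; exact aux_char V (by rw [hg, h])
    have e3 : (n:ℂ) * (n - 1) * p * p = d * (2 * d + 4 * (n - 2) * q + (n - 2) * (n - 3) * (r * d)) := by
      linear_combination d * e2 - p * e1
    have e4 : (n:ℝ) * (n - 1) * p * p = d * (2 * d + 4 * (n - 2) * q + (n - 2) * (n - 3) * (r * d)) := by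
      exact_mod_cast e3
    have e5 : 0 ≤ 2 * d + 4 * (n - 2) * q + (n - 2) * (n - 3) * (r * d) := by
      refine (mul_nonneg_iff_of_pos_left hdpos).1 ?_
      rw [← e4, mul_assoc]
      exact mul_nonneg (mul_nonneg (by linarith) (by linarith)) (mul_self_nonneg p)
    have e6 : 4 * ((n:ℝ) - 2) * q < 4 * (n - 2) * d := 
      mul_lt_mul_of_pos_left hlt (by linarith)
    have e7 : 0 < d * (4 * n - 6 + r * ((n - 2) * (n - 3))) := by linarith
    have e8 := pos_of_mul_pos_right e7 hdpos.le
    rw [gt_iff_lt, ← neg_div, div_lt_iff₀ (mul_pos (by linarith) (by linarith))]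
    linarith
  · have ht1 := hqe heq
    have hker : alternatingGroup (Fin n) ≤ V.ρ.ker := by
      rw [← closure_three_cycles_eq_alternating, Subgroup.closure_le]
      intro x hx
      obtain ⟨y, hy⟩ := isConj_iff.1 (isConj_iff_cycleType_eq.2 (htc.cycleType.trans hx.cycleType.symm))
      change V.ρ x = 1
      rw [← hy, map_mul, map_mul, ht1, mul_one, ← map_mul, mul_inv_cancel, map_one]
    have hgA : V.ρ g = 1 := hker (by
      rw [mem_alternatingGroup, sign_of_cycleType, hg]; decide)
    have : V.character g = d := by
      rw [← hdC]; unfold FDRep.character; rw [hgA, map_one V.ρ]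
    rw [this] at hr
    have hr2 : d = r * d := by exact_mod_cast hr
    have : r = 1 := by
      have : (r - 1) * d = 0 := by linarith
      rcases mul_eq_zero.1 this with h | h
      · linarith
      · exact absurd h hdpos.ne'
    rw [this]; linarith
end
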